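/- arXiv:1207.5643 — 5 statements merged into one kernel-verified Lean document; each statement's English description precedes it below -/
import Mathlib

section
/- Let D be a strongly connected digraph on n ≥ 5 vertices with minimum semi-degree at least 2 that satisfies condition (*) and contains no cycle of length n − 1. Let C = x₁x₂…x_{n−2}x₁ be a cycle of length n − 2 in D and let y, z be the two vertices of D not on C. If exactly one of the arcs yz and zy belongs to A(D), then n is even and D is isomorphic to K*_{n/2,n/2} minus one arc. -/
/-!
Digraphs are modelled as a finite vertex type `V` together with an arc relation
`A : V → V → Prop` (irreflexive, i.e. no loops; no multiple arcs by construction).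
-/

namespace PaperDG

variable {V : Type*}

/-- Out-degree of `v`: the number of out-neighbours. -/
noncomputable def outDeg (A : V → V → Prop) (v : V) : ℕ := Nat.card {w : V // A v w}

/-- In-degree of `v`: the number of in-neighbours. -/
noncomputable def inDeg (A : V → V → Prop) (v : V) : ℕ := Nat.card {w : V // A w v}

/-- Degree `d(v) = d⁺(v) + d⁻(v)`. -/
noncomputable def deg (A : V → V → Prop) (v : V) : ℕ := outDeg A v + inDeg A v

/-- Strong connectivity: every vertex reaches every other by a directed path. -/
def IsStrong (A : V → V → Prop) : Prop := ∀ x y : V, Relation.ReflTransGen A x y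

/-- The digraph has a directed cycle through `k` distinct vertices. -/
def HasCycle (A : V → V → Prop) (k : ℕ) : Prop :=
  ∃ f : ZMod k → V, Function.Injective f ∧ ∀ i : ZMod k, A (f i) (f (i + 1))

/-- Condition (*): `d(x) + d(y) ≥ 2n - 1` and `min {d(x), d(y)} ≥ n - 1` for every pair of
non-adjacent vertices `x, y` with a common in-neighbour. -/
def CondStar [Fintype V] (A : V → V → Prop) : Prop :=
  ∀ x y : V, x ≠ y → ¬A x y → ¬A y x → (∃ u : V, A u x ∧ A u y) →
    2 * Fintype.card V - 1 ≤ deg A x + deg A y ∧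
      Fintype.card V - 1 ≤ min (deg A x) (deg A y)

/-- Condition (**): `min {d⁺(x) + d⁻(y), d⁻(x) + d⁺(y)} ≥ n` for every pair of non-adjacent
vertices `x, y` with a common in-neighbour or a common out-neighbour. -/
def CondStarStar [Fintype V] (A : V → V → Prop) : Prop :=
  ∀ x y : V, x ≠ y → ¬A x y → ¬A y x →
    ((∃ u : V, A u x ∧ A u y) ∨ (∃ u : V, A x u ∧ A y u)) →
    Fintype.card V ≤ min (outDeg A x + inDeg A y) (inDeg A x + outDeg A y)

/-- The digraph is (isomorphic to) the complete bipartite digraph `K*_{n/2,n/2}`: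
there is a part `S` of size `n/2` such that the arcs are exactly the pairs of vertices
lying in different parts. -/
def IsKhalf [Fintype V] (A : V → V → Prop) : Prop :=
  ∃ S : Set V, 2 * Nat.card S = Fintype.card V ∧
    ∀ x y : V, A x y ↔ (x ∈ S ↔ y ∉ S)

/-- The digraph is (isomorphic to) `K*_{n/2,n/2}` minus one arc. -/
def IsKhalfMinusArc [Fintype V] (A : V → V → Prop) : Prop :=
  ∃ S : Set V, ∃ a b : V, 2 * Nat.card S = Fintype.card V ∧ (a ∈ S ↔ b ∉ S) ∧
    ∀ x y : V, A x y ↔ ((x ∈ S ↔ y ∉ S) ∧ ¬(x = a ∧ y = b))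

/-- Minimum semi-degree at least `k`. -/
def MinSemiDegreeGE (A : V → V → Prop) (k : ℕ) : Prop :=
  ∀ v : V, k ≤ outDeg A v ∧ k ≤ inDeg A v

/-- Locally semicomplete: for every vertex `x` the out-neighbourhood and the
in-neighbourhood of `x` both induce semicomplete digraphs. -/
def LocallySemicomplete (A : V → V → Prop) : Prop :=
  ∀ x u v : V, u ≠ v →
    ((A x u → A x v → A u v ∨ A v u) ∧ (A u x → A v x → A u v ∨ A v u))

end PaperDG


namespace PaperDG

structure Cyc {V : Type*} (A : V → V → Prop) (m : ℕ) (x : ℕ → V) : Prop where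
  per : ∀ i, x (i + m) = x i
  inj : ∀ i j, i < m → j < m → x i = x j → i = j
  arc : ∀ i, A (x i) (x (i + 1))

section
variable {V : Type*} {A : V → V → Prop} {m : ℕ} {x : ℕ → V}

theorem Cyc.mod (h : Cyc A m x) (i : ℕ) : x (i % m) = x i :=
  Function.Periodic.map_mod_nat h.per i

theorem Cyc.inj_mod (h : Cyc A m x) (hm : 0 < m) {i j : ℕ} (e : x i = x j) : i % m = j % m := by
  apply h.inj _ _ (Nat.mod_lt _ hm) (Nat.mod_lt _ hm)
  rw [h.mod, h.mod, e]

theorem Cyc.of_mod (h : Cyc A m x) {i j : ℕ} (e : i % m = j % m) : x i = x j := by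
  rw [← h.mod i, ← h.mod j, e]

theorem Cyc.shift (h : Cyc A m x) (hm : 0 < m) (i : ℕ) : Cyc A m (fun j => x (i + j)) where
  per j := by rw [← add_assoc, h.per]
  inj a b ha hb e := by
    have := h.inj_mod hm e
    have h2 : a ≡ b [MOD m] := Nat.ModEq.add_left_cancel' i this
    have h3 : a % m = b % m := h2
    rwa [Nat.mod_eq_of_lt ha, Nat.mod_eq_of_lt hb] at h3
  arc j := h.arc (i + j)

theorem hasCycle_of_nat {k : ℕ} (hk : 2 ≤ k) (g : ℕ → V)
    (hi : ∀ i j, i < k → j < k → g i = g j → i = j)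
    (ha : ∀ i, i + 1 < k → A (g i) (g (i + 1))) (hl : A (g (k - 1)) (g 0)) : HasCycle A k := by
  have : NeZero k := ⟨by omega⟩
  have : Fact (1 < k) := ⟨by omega⟩
  refine ⟨fun i => g i.val, ?_, ?_⟩
  · intro a b e
    exact ZMod.val_injective k (hi _ _ (ZMod.val_lt a) (ZMod.val_lt b) e)
  · intro i
    have hlt := ZMod.val_lt i
    have h1 : (i + 1).val = (i.val + 1) % k := by rw [ZMod.val_add, ZMod.val_one]
    simp only [h1]
    by_cases hc : i.val + 1 < k
    · rw [Nat.mod_eq_of_lt hc]; exact ha _ hc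
    · have : i.val + 1 = k := by omega
      rw [this, Nat.mod_self]
      have : i.val = k - 1 := by omega
      rw [this]; exact hl

theorem Cyc.insert (h : Cyc A m x) (hm : 3 ≤ m) {u : V} (hu : ∀ i, u ≠ x i) (i : ℕ)
    (h1 : A (x i) u) (h2 : A u (x (i + 1))) : HasCycle A (m + 1) := by
  have hs := h.shift (by omega) (i + 1)
  refine hasCycle_of_nat (by omega) (fun j => if j < m then x (i + 1 + j) else u) ?_ ?_ ?_
  · intro a b ha hb e
    by_cases h1 : a < m <;> by_cases h2 : b < m <;> simp only [h1, h2, if_true, if_false] at e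
    · exact hs.inj a b h1 h2 e
    · exact absurd e.symm (hu _)
    · exact absurd e (hu _)
    · omega
  · intro j hj
    by_cases h3 : j + 1 < m
    · simp only [h3, (by omega : j < m), if_true]; exact h.arc _
    · simp only [h3, (by omega : j < m), if_true, if_false]
      have : x (i + 1 + j) = x i := by
        rw [← h.per i]; congr 1; omega
      rw [this]; exact h1
  · simp only [Nat.add_sub_cancel, lt_irrefl, if_false, (by omega : 0 < m), if_true]
    exact h2

theorem Cyc.insert2 (h : Cyc A m x) (hm : 3 ≤ m) {u v : V} (hu : ∀ i, u ≠ x i)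
    (hv : ∀ i, v ≠ x i) (huv : u ≠ v) (i : ℕ)
    (h1 : A (x i) u) (h2 : A u v) (h3 : A v (x (i + 2))) : HasCycle A (m + 1) := by
  have hs := h.shift (by omega) (i + 2)
  refine hasCycle_of_nat (by omega)
    (fun j => if j < m - 1 then x (i + 2 + j) else if j = m - 1 then u else v) ?_ ?_ ?_
  · intro a b ha hb e
    by_cases h1 : a < m - 1 <;> by_cases h2 : b < m - 1 <;>
      simp only [h1, h2, if_true, if_false] at e
    · exact hs.inj a b (by omega) (by omega) e
    · split_ifs at e
      · exact absurd e.symm (hu _)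
      · exact absurd e.symm (hv _)
    · split_ifs at e
      · exact absurd e (hu _)
      · exact absurd e (hv _)
    · split_ifs at e
      · omega
      · exact absurd e huv
      · exact absurd e.symm huv
      · omega
  · intro j hj
    by_cases h4 : j + 1 < m - 1
    · simp only [h4, (by omega : j < m - 1), if_true]; exact h.arc _
    · by_cases h5 : j + 1 = m - 1
      · simp only [h5, lt_irrefl, (by omega : j < m - 1), if_true, if_false]
        have : x (i + 2 + j) = x i := by
          rw [← h.per i]; congr 1; omega
        rw [this]; exact h1
      · simp only [h4, h5, (by omega : ¬ j < m - 1), (by omega : j = m - 1), if_true, if_false]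
        rw [if_neg (lt_irrefl _), if_neg (by omega), if_neg (by omega)]
        exact h2
  · simp only [Nat.add_sub_cancel]
    rw [if_neg (by omega), if_neg (by omega), if_pos (by omega)]
    exact h3

/-- replace the vertex at index `r` by `u` -/
def repl (m : ℕ) (x : ℕ → V) (r : ℕ) (u : V) : ℕ → V :=
  fun j => if j % m = r % m then u else x j

theorem repl_eq {r j : ℕ} {u : V} (h : j % m = r % m) : repl m x r u j = u := by
  simp [repl, h]

theorem repl_ne {r j : ℕ} {u : V} (h : j % m ≠ r % m) : repl m x r u j = x j := by
  simp [repl, h]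

theorem succ_mod_ne (hm : 3 ≤ m) (j : ℕ) : (j + 1) % m ≠ j % m := by
  intro h
  have h2 : j + 1 ≡ j + 0 [MOD m] := h
  have h3 : 1 % m = 0 % m := Nat.ModEq.add_left_cancel' j h2
  rw [Nat.mod_eq_of_lt (by omega), Nat.mod_eq_of_lt (by omega)] at h3
  omega

theorem Cyc.repl (h : Cyc A m x) (hm : 3 ≤ m) {u : V} (hu : ∀ i, u ≠ x i) (r : ℕ)
    (h1 : A (x r) u) (h2 : A u (x (r + 2))) : Cyc A m (repl m x (r + 1) u) where
  per i := by simp only [PaperDG.repl, Nat.add_mod_right, h.per]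
  inj i j hi hj e := by
    simp only [PaperDG.repl] at e
    split_ifs at e with h3 h4 h4
    · rw [Nat.mod_eq_of_lt hi] at h3
      rw [Nat.mod_eq_of_lt hj] at h4
      omega
    · exact absurd e (hu _)
    · exact absurd e.symm (hu _)
    · exact h.inj i j hi hj e
  arc i := by
    simp only [PaperDG.repl]
    split_ifs with h3 h4 h4
    · exact absurd (h4.trans h3.symm) (succ_mod_ne hm i)
    · have : x (i + 1) = x (r + 2) := h.of_mod (Nat.ModEq.add_right 1 h3)
      rw [this]; exact h2
    · have : x i = x r := h.of_mod (Nat.ModEq.add_right_cancel' 1 h4)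
      rw [this]; exact h1
    · exact h.arc i

theorem Cyc.repl_off (h : Cyc A m x) (hm : 3 ≤ m) {u : V} (hu : ∀ i, u ≠ x i) (r : ℕ) :
    ∀ i, x r ≠ PaperDG.repl m x r u i := by
  intro i
  simp only [PaperDG.repl]
  split_ifs with h3
  · exact (hu _).symm
  · intro e; exact h3 (h.inj_mod (by omega) e).symm

theorem repl_off' {u v : V} (huv : u ≠ v) (hv : ∀ i, v ≠ x i) (r : ℕ) :
    ∀ i, v ≠ PaperDG.repl m x r u i := by
  intro i
  simp only [PaperDG.repl]
  split_ifs with h3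
  · exact huv.symm
  · exact hv _

variable [Fintype V]

open Classical in
theorem Cyc.univ (h : Cyc A m x) (hm : 3 ≤ m) (hc : Fintype.card V = m + 2) {u v : V}
    (hu : ∀ i, u ≠ x i) (hv : ∀ i, v ≠ x i) (huv : u ≠ v) :
    (Finset.univ : Finset V) = Insert.insert u (Insert.insert v ((Finset.range m).image x)) := by
  symm
  apply Finset.eq_univ_of_card
  have h3 : ((Finset.range m).image x).card = m := by
    rw [Finset.card_image_of_injOn, Finset.card_range]
    intro a ha b hb e
    simp at ha hb
    exact h.inj a b ha hb e
  rw [Finset.card_insert_of_notMem, Finset.card_insert_of_notMem, h3, hc]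
  · simp only [Finset.mem_image, not_exists, not_and]
    intro a _ e; exact hv a e.symm
  · simp only [Finset.mem_insert, Finset.mem_image, not_or, not_exists, not_and]
    exact ⟨huv, fun a _ e => hu a e.symm⟩

theorem Cyc.cases (h : Cyc A m x) (hm : 3 ≤ m) (hc : Fintype.card V = m + 2) {u v : V}
    (hu : ∀ i, u ≠ x i) (hv : ∀ i, v ≠ x i) (huv : u ≠ v) (w : V) :
    w = u ∨ w = v ∨ ∃ i, i < m ∧ w = x i := by
  classical
  have : w ∈ (Finset.univ : Finset V) := Finset.mem_univ _
  rw [h.univ hm hc hu hv huv] at this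
  simp only [Finset.mem_insert, Finset.mem_image, Finset.mem_range] at this
  rcases this with h | h | ⟨i, hi, e⟩
  · exact Or.inl h
  · exact Or.inr (Or.inl h)
  · exact Or.inr (Or.inr ⟨i, hi, e.symm⟩)

theorem Cyc.sum (h : Cyc A m x) (hm : 3 ≤ m) (hc : Fintype.card V = m + 2) {u v : V}
    (hu : ∀ i, u ≠ x i) (hv : ∀ i, v ≠ x i) (huv : u ≠ v) (g : V → ℕ) :
    ∑ w, g w = g u + (g v + ∑ i ∈ Finset.range m, g (x i)) := by
  classical
  rw [h.univ hm hc hu hv huv, Finset.sum_insert, Finset.sum_insert, Finset.sum_image]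
  · intro a ha b hb e
    simp at ha hb
    exact h.inj a b ha hb e
  · simp only [Finset.mem_image, not_exists, not_and]
    intro a _ e; exact hv a e.symm
  · simp only [Finset.mem_insert, Finset.mem_image, not_or, not_exists, not_and]
    exact ⟨huv, fun a _ e => hu a e.symm⟩

open Classical in
theorem outDeg_eq (u : V) : outDeg A u = ∑ w, if A u w then 1 else 0 := by
  rw [outDeg, Nat.card_eq_fintype_card, Fintype.card_subtype, Finset.card_filter]

open Classical in
theorem inDeg_eq (u : V) : inDeg A u = ∑ w, if A w u then 1 else 0 := by
  rw [inDeg, Nat.card_eq_fintype_card, Fintype.card_subtype, Finset.card_filter]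

open Classical in
theorem Cyc.deg_eq (h : Cyc A m x) (hirr : ∀ v, ¬ A v v) (hm : 3 ≤ m)
    (hc : Fintype.card V = m + 2) {u v : V}
    (hu : ∀ i, u ≠ x i) (hv : ∀ i, v ≠ x i) (huv : u ≠ v) :
    deg A u = (if A u v then 1 else 0) + (if A v u then 1 else 0) +
      ∑ i ∈ Finset.range m, ((if A u (x (i + 1)) then 1 else 0) + (if A (x i) u then 1 else 0)) := by
  have hsh : ∑ i ∈ Finset.range m, (if A u (x (i + 1)) then 1 else 0) =
      ∑ i ∈ Finset.range m, (if A u (x i) then 1 else 0) := by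
    have h1 := Finset.sum_range_succ (fun i => if A u (x i) then 1 else 0) m
    have h2 := Finset.sum_range_succ' (fun i => if A u (x i) then 1 else 0) m
    have h3 : x m = x 0 := by simpa using h.per 0
    rw [h3] at h1
    omega
  rw [Finset.sum_add_distrib, hsh, deg, outDeg_eq, inDeg_eq, h.sum hm hc hu hv huv,
    h.sum hm hc hu hv huv]
  simp only [hirr, if_false]
  omega

open Classical in
theorem Cyc.deg_le (h : Cyc A m x) (hirr : ∀ v, ¬ A v v) (hm : 3 ≤ m)
    (hc : Fintype.card V = m + 2) (hno : ¬ HasCycle A (m + 1)) {u v : V}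
    (hu : ∀ i, u ≠ x i) (hv : ∀ i, v ≠ x i) (huv : u ≠ v) :
    deg A u ≤ (if A u v then 1 else 0) + (if A v u then 1 else 0) + m ∧
    ((if A u v then 1 else 0) + (if A v u then 1 else 0) + m ≤ deg A u →
      ∀ i, A u (x (i + 1)) ↔ ¬ A (x i) u) := by
  have hb : ∀ i, (if A u (x (i + 1)) then 1 else 0) + (if A (x i) u then 1 else 0) ≤ 1 := by
    intro i
    by_cases h1 : A u (x (i + 1)) <;> by_cases h2 : A (x i) u <;> simp [h1, h2]
    exact hno (h.insert hm hu i h2 h1)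
  rw [h.deg_eq hirr hm hc hu hv huv]
  have hs : ∑ i ∈ Finset.range m, ((if A u (x (i + 1)) then 1 else 0) +
      (if A (x i) u then 1 else 0)) ≤ m := by
    calc _ ≤ ∑ i ∈ Finset.range m, 1 := Finset.sum_le_sum (fun i _ => hb i)
      _ = m := by simp
  refine ⟨by omega, ?_⟩
  intro hge
  have hlt : ∀ i, i < m → (A u (x (i + 1)) ↔ ¬ A (x i) u) := by
    intro i hi
    constructor
    · intro h1 h2; exact hno (h.insert hm hu i h2 h1)
    · intro h2
      by_contra h1
      have : ∑ i ∈ Finset.range m, ((if A u (x (i + 1)) then 1 else 0) +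
          (if A (x i) u then 1 else 0)) < ∑ i ∈ Finset.range m, 1 :=
        Finset.sum_lt_sum (fun i _ => hb i) ⟨i, by simpa using hi, by simp [h1, h2]⟩
      simp only [Finset.sum_const, Finset.card_range, smul_eq_mul, mul_one] at this
      omega
  intro i
  have := hlt (i % m) (Nat.mod_lt _ (by omega))
  rw [h.mod, h.of_mod (show (i % m + 1) % m = (i + 1) % m by simp)] at this
  exact this

theorem exists_out (hsemi : MinSemiDegreeGE A 2) (u v : V) : ∃ w, w ≠ v ∧ A u w := by
  classical
  by_contra hcon
  push Not at hcon
  have h1 := (hsemi u).1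
  rw [outDeg_eq] at h1
  have h2 : ∑ w, (if A u w then 1 else 0) ≤ ∑ w, (if w = v then 1 else 0) := by
    apply Finset.sum_le_sum
    intro w _
    by_cases e : w = v
    · simp only [e, if_true]; split_ifs <;> omega
    · simp [e, hcon w e]
  simp at h2 h1
  omega

theorem exists_in (hsemi : MinSemiDegreeGE A 2) (u v : V) : ∃ w, w ≠ v ∧ A w u := by
  classical
  by_contra hcon
  push Not at hcon
  have h1 := (hsemi u).2
  rw [inDeg_eq] at h1
  have h2 : ∑ w, (if A w u then 1 else 0) ≤ ∑ w, (if w = v then 1 else 0) := by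
    apply Finset.sum_le_sum
    intro w _
    by_cases e : w = v
    · simp only [e, if_true]; split_ifs <;> omega
    · simp [e, hcon w e]
  simp at h2 h1
  omega

theorem Cyc.struct (h : Cyc A m x) (hirr : ∀ v, ¬ A v v) (hm : 3 ≤ m)
    (hc : Fintype.card V = m + 2) (hno : ¬ HasCycle A (m + 1))
    (hsemi : MinSemiDegreeGE A 2) (hstar : CondStar A) {u v : V}
    (hu : ∀ i, u ≠ x i) (hv : ∀ i, v ≠ x i) (huv : u ≠ v) (hne : ¬ (A u v ∧ A v u)) :
    deg A u ≤ m + 1 ∧ (∀ i, A u (x (i + 1)) ↔ ¬ A (x i) u) ∧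
    (∃ i, A (x i) u ∧ ¬ A (x (i + 1)) u) ∧
    (∀ i, A (x i) u → ¬ A (x (i + 1)) u → m + 2 ≤ deg A (x (i + 1))) := by
  classical
  have hd := h.deg_le hirr hm hc hno hu hv huv
  have he : (if A u v then 1 else 0) + (if A v u then 1 else 0) ≤ 1 := by
    by_cases h1 : A u v <;> by_cases h2 : A v u <;> simp [h1, h2]
    exact hne ⟨h1, h2⟩
  have hle : deg A u ≤ m + 1 := by omega
  have hex : ∃ i, A (x i) u ∧ ¬ A (x (i + 1)) u := by
    by_contra hcon
    push Not at hcon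
    obtain ⟨w, hwv, hw⟩ := exists_in hsemi u v
    obtain ⟨w', hwv', hw'⟩ := exists_out hsemi u v
    have hwx : ∃ i, i < m ∧ A (x i) u := by
      rcases h.cases hm hc hu hv huv w with e | e | ⟨i, hi, e⟩
      · exact absurd (e ▸ hw) (hirr _)
      · exact absurd e hwv
      · exact ⟨i, hi, e ▸ hw⟩
    have hwx' : ∃ i, A u (x i) := by
      rcases h.cases hm hc hu hv huv w' with e | e | ⟨i, hi, e⟩
      · exact absurd (e ▸ hw') (hirr _)
      · exact absurd e hwv'
      · exact ⟨i, e ▸ hw'⟩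
    obtain ⟨i, hi, hA⟩ := hwx
    obtain ⟨j, hj⟩ := hwx'
    have hall : ∀ k, A (x (i + k)) u := by
      intro k
      induction k with
      | zero => exact hA
      | succ k ih => exact hcon _ ih
    have h1 : A (x (j + m - 1 + m)) u := by
      have := hall (j + m - 1 + m - i)
      rwa [show i + (j + m - 1 + m - i) = j + m - 1 + m by omega] at this
    rw [h.per] at h1
    rw [← h.per, show j + m = j + m - 1 + 1 by omega] at hj
    exact hno (h.insert hm hu _ h1 hj)
  have hst : ∀ i, A (x i) u → ¬ A (x (i + 1)) u →
      2 * Fintype.card V - 1 ≤ deg A (x (i + 1)) + deg A u ∧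
      Fintype.card V - 1 ≤ min (deg A (x (i + 1))) (deg A u) := by
    intro i h1 h2
    exact hstar _ _ (hu _).symm h2 (fun h3 => hno (h.insert hm hu i h1 h3)) ⟨x i, h.arc i, h1⟩
  refine ⟨hle, ?_, hex, ?_⟩
  · obtain ⟨i, h1, h2⟩ := hex
    have h3 := (hst i h1 h2).2
    apply hd.2
    have := (le_min_iff.1 h3).2
    omega
  · intro i h1 h2
    have := (hst i h1 h2).1
    omega

/-- context facts -/
structure Ctx (A : V → V → Prop) (m : ℕ) (x : ℕ → V) (y z : V) : Prop where
  c : Cyc A m x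
  irr : ∀ v, ¬ A v v
  hm : 3 ≤ m
  hc : Fintype.card V = m + 2
  no : ¬ HasCycle A (m + 1)
  semi : MinSemiDegreeGE A 2
  star : CondStar A
  hy : ∀ i, y ≠ x i
  hz : ∀ i, z ≠ x i
  hyz : y ≠ z
  ayz : A y z
  azy : ¬ A z y

variable {y z : V}

theorem Ctx.shift (h : Ctx A m x y z) (i : ℕ) : Ctx A m (fun j => x (i + j)) y z :=
  { h with
    c := h.c.shift (by have := h.hm; omega) i
    hy := fun j => h.hy _
    hz := fun j => h.hz _ }

theorem Ctx.sy (h : Ctx A m x y z) :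
    deg A y ≤ m + 1 ∧ (∀ i, A y (x (i + 1)) ↔ ¬ A (x i) y) ∧
    (∃ i, A (x i) y ∧ ¬ A (x (i + 1)) y) ∧
    (∀ i, A (x i) y → ¬ A (x (i + 1)) y → m + 2 ≤ deg A (x (i + 1))) :=
  h.c.struct h.irr h.hm h.hc h.no h.semi h.star h.hy h.hz h.hyz
  (fun h1 => h.azy h1.2)

theorem Ctx.sz (h : Ctx A m x y z) :
    deg A z ≤ m + 1 ∧ (∀ i, A z (x (i + 1)) ↔ ¬ A (x i) z) ∧
    (∃ i, A (x i) z ∧ ¬ A (x (i + 1)) z) ∧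
    (∀ i, A (x i) z → ¬ A (x (i + 1)) z → m + 2 ≤ deg A (x (i + 1))) :=
  h.c.struct h.irr h.hm h.hc h.no h.semi h.star h.hz h.hy
  h.hyz.symm (fun h1 => h.azy h1.1)

theorem Ctx.yz (h : Ctx A m x y z) (i : ℕ) (hi : A (x i) y) : A (x (i + 1)) z := by
  by_contra hcon
  exact h.no (h.c.insert2 h.hm h.hy h.hz h.hyz i hi h.ayz ((h.sz.2.1 (i + 1)).2 hcon))

theorem Ctx.fa (h : Ctx A m x y z) (i : ℕ) (hi : A (x i) y) (hi' : ¬ A (x (i + 1)) y) :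
    ¬ A (x i) z := by
  intro hcon
  have hr := h.c.repl h.hm h.hy i hi ((h.sy.2.1 (i + 1)).2 hi')
  have h1 := hr.struct h.irr h.hm h.hc h.no h.semi h.star (h.c.repl_off h.hm h.hy (i + 1))
    (repl_off' h.hyz h.hz (i + 1)) (h.hz _).symm
    (fun h1 => (h.sz.2.1 i).1 h1.2 hcon)
  have h2 := h.sy.2.2.2 i hi hi'
  have := h1.1
  omega

theorem Ctx.fb (h : Ctx A m x y z) (i : ℕ) (hi : A (x i) z) (hi' : ¬ A (x (i + 1)) z) :
    A (x (i + 1)) y := by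
  by_contra hcon
  have hr := h.c.repl h.hm h.hz i hi ((h.sz.2.1 (i + 1)).2 hi')
  have h1 := hr.struct h.irr h.hm h.hc h.no h.semi h.star (h.c.repl_off h.hm h.hz (i + 1))
    (repl_off' h.hyz.symm h.hy (i + 1)) (h.hy _).symm
    (fun h1 => hcon h1.1)
  have h2 := h.sz.2.2.2 i hi hi'
  have := h1.1
  omega

theorem Ctx.disj (h : Ctx A m x y z) (i : ℕ) (hi : A (x i) y) : ¬ A (x i) z := by
  intro hiz
  have hall : ∀ k, A (x (i + k)) y ∧ A (x (i + k)) z := by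
    intro k
    induction k with
    | zero => exact ⟨hi, hiz⟩
    | succ k ih =>
      refine ⟨?_, h.yz _ ih.1⟩
      by_contra hcon
      exact h.fa _ ih.1 hcon ih.2
  obtain ⟨j, _, hj⟩ := h.sy.2.2.1
  apply hj
  have := (hall ((j + 1) + i * m - i)).1
  have h3 : i + (j + 1 + i * m - i) = j + 1 + i * m := by
    have : i ≤ i * m := Nat.le_mul_of_pos_right _ (by have := h.hm; omega)
    omega
  rw [h3, h.c.of_mod (show (j + 1 + i * m) % m = (j + 1) % m by simp)] at this
  exact this

/-- facts when `x 0 → y` -/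
theorem Ctx.p3 (h : Ctx A m x y z) (h0 : A (x 0) y) :
    (¬ A (x 1) (x 3)) ∧
    (∀ j, 2 ≤ j → j + 2 ≤ m → A (x j) (x 1) → A (x (j + 1)) z) ∧
    (∀ j, 2 ≤ j → j + 2 ≤ m → A (x j) z → ¬ A (x 1) (x (j + 2))) ∧
    (∀ j, 2 ≤ j → j < m → (A (x 1) (x (j + 1)) ↔ ¬ A (x j) (x 1))) := by
  have hm := h.hm
  have h1z : A (x 1) z := h.yz 0 h0
  have h1y : ¬ A (x 1) y := fun h1 => h.disj 1 h1 h1z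
  have hz1 : A z (x 1) := (h.sz.2.1 0).2 (h.disj 0 h0)
  have hr := h.c.repl h.hm h.hy 0 h0 ((h.sy.2.1 1).2 h1y)
  have o1 := h.c.repl_off h.hm h.hy 1
  have oz := repl_off' (m := m) h.hyz h.hz 1
  have hne : x 1 ≠ z := (h.hz _).symm
  have e1 : repl m x 1 y 1 = y := repl_eq rfl
  have ej : ∀ j, 2 ≤ j → j ≤ m → repl m x 1 y j = x j := by
    intro j h1 h2
    apply repl_ne
    rw [Nat.mod_eq_of_lt (show 1 < m by omega)]
    rcases Nat.lt_or_ge j m with h3 | h3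
    · rw [Nat.mod_eq_of_lt h3]; omega
    · rw [show j = m by omega, Nat.mod_self]; omega
  have hd := hr.deg_le h.irr h.hm h.hc h.no o1 oz hne
  have hdeg := h.sy.2.2.2 0 h0 h1y
  refine ⟨?_, ?_, ?_, ?_⟩
  · intro hcon
    refine h.no (hr.insert2 hm oz o1 hne.symm 1 ?_ hz1 ?_)
    · simp only [zero_add, e1]; exact h.ayz
    · simp only [zero_add, ej 3 (by omega) hm]; exact hcon
  · intro j h2 hj hA
    by_contra hcon
    refine h.no (hr.insert2 hm o1 oz hne j ?_ h1z ?_)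
    · simp only [zero_add, ej j h2 (by omega)]; exact hA
    · simp only [zero_add, ej (j + 2) (by omega) (by omega)]; exact (h.sz.2.1 (j + 1)).2 hcon
  · intro j h2 hj hA hcon
    refine h.no (hr.insert2 hm oz o1 hne.symm j ?_ hz1 ?_)
    · simp only [zero_add, ej j h2 (by omega)]; exact hA
    · simp only [zero_add, ej (j + 2) (by omega) (by omega)]; exact hcon
  · intro j h2 hj
    have := hd.2 (by simp only [h1z, hz1, if_true]; simp only [zero_add] at hdeg; omega) j
    simp only [zero_add, ej j h2 (by omega), ej (j + 1) (by omega) (by omega)] at this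
    exact this

theorem Ctx.next (h : Ctx A m x y z) (h0 : A (x 0) y) : A (x 2) y := by
  have hm := h.hm
  by_contra hcon
  have h1z : A (x 1) z := h.yz 0 h0
  have h2z : A (x 2) z := by
    by_contra h2
    exact hcon (h.fb 1 h1z h2)
  obtain ⟨f1, f2, f3, f4⟩ := h.p3 h0
  have key : ∀ k, (2 + k < m → A (x (2 + k)) z) ∧ (3 + k < m → A (x (3 + k)) z) := by
    intro k
    induction k with
    | zero =>
      refine ⟨fun _ => h2z, fun h3 => f2 2 le_rfl (by omega) ?_⟩
      by_contra h4
      exact f1 ((f4 2 le_rfl (by omega)).2 h4)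
    | succ k ih =>
      refine ⟨fun h3 => ?_, fun h3 => ?_⟩
      · have := ih.2 (by omega)
        rwa [show 2 + (k + 1) = 3 + k by omega]
      · have h4 := f3 _ (by omega) (by omega) (ih.1 (by omega))
        have h5 : A (x (2 + k + 1)) (x 1) := by
          by_contra h6
          exact h4 ((f4 (2 + k + 1) (by omega) (by omega)).2 h6)
        have h7 := f2 _ (by omega) (by omega) h5
        rwa [show 3 + (k + 1) = 2 + k + 1 + 1 by omega]
  obtain ⟨w, hw0, hw⟩ := exists_in h.semi y (x 0)
  rcases h.c.cases hm h.hc h.hy h.hz h.hyz w with e | e | ⟨i, hi, e⟩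
  · exact h.irr _ (e ▸ hw)
  · exact h.azy (e ▸ hw)
  · subst e
    refine h.disj i hw ?_
    rcases Nat.lt_or_ge i 2 with h3 | h3
    · interval_cases i
      · exact absurd rfl hw0
      · exact h1z
    · have := (key (i - 2)).1 (by omega)
      rwa [show 2 + (i - 2) = i by omega] at this

theorem Ctx.evens (h : Ctx A m x y z) (h0 : A (x 0) y) (k : ℕ) : A (x (2 * k)) y := by
  induction k with
  | zero => exact h0
  | succ k ih => exact (h.shift (2 * k)).next ih

theorem Ctx.parY (h : Ctx A m x y z) (h0 : A (x 0) y) (k : ℕ) : A (x k) y ↔ Even k := by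
  constructor
  · intro hk
    by_contra hcon
    rw [Nat.not_even_iff_odd] at hcon
    obtain ⟨r, rfl⟩ := hcon
    exact h.disj _ hk (h.yz _ (h.evens h0 r))
  · intro hk
    obtain ⟨r, rfl⟩ := hk
    have := h.evens h0 r
    rwa [two_mul] at this

theorem Ctx.parZ (h : Ctx A m x y z) (h0 : A (x 0) y) (k : ℕ) : A (x k) z ↔ ¬ Even k := by
  constructor
  · intro hk he
    exact h.disj _ ((h.parY h0 k).2 he) hk
  · intro hk
    rw [Nat.not_even_iff_odd] at hk
    obtain ⟨r, rfl⟩ := hk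
    exact h.yz _ (h.evens h0 r)

theorem Ctx.evm (h : Ctx A m x y z) (h0 : A (x 0) y) : Even m := by
  rw [← h.parY h0]
  have := h.c.per 0
  rw [zero_add] at this
  rwa [this]

theorem Ctx.one (h : Ctx A m x y z) (h0 : A (x 0) y) (j : ℕ) (hj : j < m) :
    (A (x 1) (x (j + 1)) ↔ ¬ Even j) ∧ (A (x j) (x 1) ↔ Even j) := by
  have hm := h.hm
  have hev := h.evm h0
  obtain ⟨f1, f2, f3, f4⟩ := h.p3 h0
  have pz := h.parZ h0
  have hoo : ∀ j, 1 ≤ j → j < m → Even j → ¬ A (x 1) (x (j + 1)) := by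
    intro j h1 h2 he
    rcases Nat.lt_or_ge j 3 with h3 | h3
    · have : j = 2 := by
        rcases (by omega : j = 1 ∨ j = 2) with rfl | rfl
        · simp at he
        · rfl
      subst this; exact f1
    · have := f3 (j - 1) (by omega) (by omega) ((pz _).2 (by
        intro h4
        have : Even (j - 1 + 1) := by rwa [show j - 1 + 1 = j by omega]
        rw [Nat.even_add_one] at this
        exact this h4))
      rwa [show j - 1 + 2 = j + 1 by omega] at this
  have hoi : ∀ j, 2 ≤ j → j < m → ¬ Even j → ¬ A (x j) (x 1) := by
    intro j h1 h2 he hA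
    have hjm : j + 2 ≤ m ∨ j + 1 = m := by omega
    rcases hjm with h3 | h3
    · have := (pz _).1 (f2 j h1 h3 hA)
      rw [Nat.even_add_one, not_not] at this
      exact he this
    · have h5 := ((h.shift (j - 1)).p3 ((h.parY h0 _).2 (by
        by_contra h6
        apply he
        rw [show j = j - 1 + 1 by omega, Nat.even_add_one]; exact h6))).1
      apply h5
      show A (x (j - 1 + 1)) (x (j - 1 + 3))
      rw [show j - 1 + 1 = j by omega, show j - 1 + 3 = 1 + m by omega, h.c.per]
      exact hA
  rcases Nat.lt_or_ge j 2 with h2 | h2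
  · rcases (by omega : j = 0 ∨ j = 1) with rfl | rfl
    · have := h.irr (x 1)
      have := h.c.arc 0
      simp_all
    · have := h.irr (x 1)
      have := h.c.arc 1
      simp_all
  · have := f4 j h2 hj
    by_cases he : Even j
    · have h3 := hoo j (by omega) hj he
      tauto
    · have h3 := hoi j h2 hj he
      tauto

theorem even_mod {m a : ℕ} (hm : Even m) : Even (a % m) ↔ Even a := by
  conv_rhs => rw [← Nat.mod_add_div a m]
  rw [Nat.even_add]
  have : Even (m * (a / m)) := hm.mul_right _
  simp [this]

theorem Ctx.rel (h : Ctx A m x y z) (h0 : A (x 0) y) (p q : ℕ) (hp : ¬ Even p) :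
    (A (x p) (x q) ↔ Even q) ∧ (A (x q) (x p) ↔ Even q) := by
  have hm := h.hm
  have hev := h.evm h0
  rw [Nat.not_even_iff_odd] at hp
  obtain ⟨i, rfl⟩ := hp
  have hone := (h.shift (2 * i)).one (h.evens h0 i)
  have hle : 2 * i ≤ 2 * i * m := Nat.le_mul_of_pos_right _ (by omega)
  have hlt : ∀ a, a % m < m := fun a => Nat.mod_lt _ (by omega)
  have hei : Even (2 * i * m) := hev.mul_left _
  have hei2 : Even (2 * i) := even_two_mul i
  have hc : ∀ a b, 2 * i + a = b + 2 * i * m → x (2 * i + a % m) = x b := by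
    intro a b e
    apply h.c.of_mod
    rw [Nat.add_mod_mod, e]; simp
  constructor
  · have h1 := (hone ((q + 2 * i * m - 2 * i + (m - 1)) % m) (hlt _)).1
    rw [even_mod hev] at h1
    have h2 : x (2 * i + ((q + 2 * i * m - 2 * i + (m - 1)) % m + 1)) = x q := by
      apply h.c.of_mod
      rw [← add_assoc, add_right_comm, Nat.add_mod_mod, add_right_comm,
        show 2 * i + (q + 2 * i * m - 2 * i + (m - 1)) + 1 = q + 2 * i * m + m by omega]
      simp
    simp only [h2] at h1
    rw [h1, ← Nat.even_add_one,
        show q + 2 * i * m - 2 * i + (m - 1) + 1 = q + 2 * i * m - 2 * i + m by omega]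
    rw [Nat.even_add, Nat.even_sub (by omega), Nat.even_add]
    simp [hev]
  · have h1 := (hone ((q + 2 * i * m - 2 * i) % m) (hlt _)).2
    rw [even_mod hev] at h1
    simp only [hc (q + 2 * i * m - 2 * i) q (by omega)] at h1
    rw [h1, Nat.even_sub (by omega), Nat.even_add]
    simp [hev]

theorem Ctx.ee (h : Ctx A m x y z) (h0 : A (x 0) y) (a b : ℕ) (ha : Even a) (hb : Even b) :
    ¬ A (x a) (x b) := by
  intro hA
  have hm := h.hm
  have hev := h.evm h0
  have hne : a % m ≠ b % m := by
    intro e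
    rw [h.c.of_mod e] at hA
    exact h.irr _ hA
  -- shift b to a positive index
  obtain ⟨r, hr⟩ : ∃ r, b + m = r + 1 := ⟨b + m - 1, by omega⟩
  have hre : ¬ Even r := by
    have : Even (r + 1) := by rw [← hr]; exact hb.add hev
    rwa [Nat.even_add_one] at this
  have hb1 : x b = x (r + 1) := by rw [← hr, h.c.per]
  have hmod : (r + 1) % m = b % m := by rw [← hr]; simp
  rw [hb1] at hA
  have hcyc := h.c.repl hm h.hz r ((h.parZ h0 r).2 hre) ((h.sz.2.1 (r + 1)).2 (by
    rw [h.parZ h0, Nat.even_add_one, not_not]; exact hre))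
  refine h.no (hcyc.insert hm (h.c.repl_off hm h.hz (r + 1)) a ?_ ?_)
  · rw [repl_ne (by rw [hmod]; exact hne)]; exact hA
  · have ho : ¬ Even (a + 1) := by rw [Nat.even_add_one, not_not]; exact ha
    rw [repl_ne]
    · exact ((h.rel h0 (a + 1) (r + 1) ho).2).2 (by rw [Nat.even_add_one]; exact hre)
    · intro e
      apply ho
      rw [← even_mod hev, e, even_mod hev, Nat.even_add_one]; exact hre

theorem Ctx.final (h : Ctx A m x y z) (h0 : A (x 0) y) :
    Even (Fintype.card V) ∧ IsKhalfMinusArc A := by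
  classical
  have hm := h.hm
  have hev := h.evm h0
  refine ⟨by rw [h.hc]; exact hev.add even_two, ?_⟩
  obtain ⟨k, hk⟩ := hev
  have hodd : ∀ i : ℕ, ¬ Even (2 * i + 1) := by intro i; simp
  let S : Finset V := Insert.insert y ((Finset.range k).image (fun i => x (2 * i + 1)))
  have hyS : y ∈ S := Finset.mem_insert_self _ _
  have hzS : z ∉ S := by
    simp only [S, Finset.mem_insert, Finset.mem_image, not_or, not_exists, not_and]
    exact ⟨h.hyz.symm, fun a _ e => h.hz _ e.symm⟩
  have hxS : ∀ i, i < m → (x i ∈ S ↔ ¬ Even i) := by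
    intro i hi
    simp only [S, Finset.mem_insert, Finset.mem_image, Finset.mem_range]
    constructor
    · rintro (e | ⟨j, hj, e⟩)
      · exact absurd e.symm (h.hy _)
      · have := h.c.inj _ _ (by omega) hi e
        rw [← this]; exact hodd j
    · intro ho
      rw [Nat.not_even_iff_odd] at ho
      obtain ⟨r, rfl⟩ := ho
      exact Or.inr ⟨r, by omega, rfl⟩
  have hcard : S.card = k + 1 := by
    rw [Finset.card_insert_of_notMem, Finset.card_image_of_injOn, Finset.card_range]
    · intro a ha b hb e
      simp at ha hb
      have := h.c.inj _ _ (by omega) (by omega) e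
      omega
    · simp only [Finset.mem_image, not_exists, not_and]
      intro a _ e; exact h.hy _ e.symm
  have yx : ∀ i, A y (x i) ↔ Even i := by
    intro i
    have h1 := h.sy.2.1 (i + m - 1)
    rw [show i + m - 1 + 1 = i + m by omega, h.c.per, h.parY h0, ← Nat.even_add_one,
      show i + m - 1 + 1 = i + m by omega, Nat.even_add] at h1
    rw [h1]; simp [hk]
  have zx : ∀ i, A z (x i) ↔ ¬ Even i := by
    intro i
    have h1 := h.sz.2.1 (i + m - 1)
    rw [show i + m - 1 + 1 = i + m by omega, h.c.per, h.parZ h0, ← Nat.even_add_one,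
      show i + m - 1 + 1 = i + m by omega, Nat.even_add] at h1
    rw [h1]; simp [hk]
  refine ⟨(S : Set V), z, y, ?_, ?_, ?_⟩
  · rw [h.hc, Nat.card_coe_set_eq, Set.ncard_coe_finset, hcard]; omega
  · simp [hyS, hzS]
  · intro p q
    simp only [Finset.mem_coe]
    have hyz := h.hyz
    have hzy := h.hyz.symm
    rcases h.c.cases hm h.hc h.hy h.hz h.hyz p with rfl | rfl | ⟨i, hi, rfl⟩ <;>
    rcases h.c.cases hm h.hc h.hy h.hz h.hyz q with rfl | rfl | ⟨j, hj, rfl⟩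
    · simp [h.irr, hyS]
    · simp [h.ayz, hyS, hzS, hyz]
    · rw [yx]; simp [hyS, hxS j hj, hyz]
    · simp [h.azy]
    · simp [h.irr, hzS]
    · rw [zx]; simp only [hzS, hxS j hj, (h.hy j).symm]; tauto
    · rw [h.parY h0]; simp only [hyS, hxS i hi, (h.hz i).symm]; tauto
    · rw [h.parZ h0]; simp only [hzS, hxS i hi, (h.hz i).symm]; tauto
    · simp only [hxS i hi, hxS j hj, (h.hz i).symm]
      by_cases hi' : Even i
      · by_cases hj' : Even j
        · have := h.ee h0 i j hi' hj'
          tauto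
        · have := (h.rel h0 j i hj').2
          tauto
      · have := (h.rel h0 i j hi').1
        tauto

theorem Ctx.main (h : Ctx A m x y z) : Even (Fintype.card V) ∧ IsKhalfMinusArc A := by
  obtain ⟨i, hi, _⟩ := h.sy.2.2.1
  exact (h.shift i).final hi

end
end PaperDG
open PaperDG

/-- Claim 6. -/
theorem darbinyan_karapetyan_claim6 {V : Type*} [Fintype V] (A : V → V → Prop)
    (hirr : ∀ v : V, ¬A v v)
    (hn : 5 ≤ Fintype.card V)
    (hstrong : IsStrong A)
    (hsemi : MinSemiDegreeGE A 2)
    (hstar : CondStar A)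
    (hnoCn1 : ¬HasCycle A (Fintype.card V - 1))
    (x : ℕ → V)
    (hper : ∀ i : ℕ, x (i + (Fintype.card V - 2)) = x i)
    (hinjC : ∀ i j : ℕ, i < Fintype.card V - 2 → j < Fintype.card V - 2 → x i = x j → i = j)
    (hcyc : ∀ i : ℕ, A (x i) (x (i + 1)))
    (y z : V) (hyz : y ≠ z)
    (hy : ∀ i : ℕ, y ≠ x i) (hz : ∀ i : ℕ, z ≠ x i)
    (hone : (A y z ∧ ¬A z y) ∨ (A z y ∧ ¬A y z)) :
    Even (Fintype.card V) ∧ IsKhalfMinusArc A := by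
  have e : Fintype.card V - 1 = Fintype.card V - 2 + 1 := by omega
  rw [e] at hnoCn1
  rcases hone with ⟨h1, h2⟩ | ⟨h1, h2⟩
  · exact Ctx.main (m := Fintype.card V - 2) (x := x) (y := y) (z := z)
      ⟨⟨hper, hinjC, hcyc⟩, hirr, by omega, by omega, hnoCn1, hsemi, hstar, hy, hz, hyz, h1, h2⟩
  · exact Ctx.main (m := Fintype.card V - 2) (x := x) (y := z) (z := y)
      ⟨⟨hper, hinjC, hcyc⟩, hirr, by omega, by omega, hnoCn1, hsemi, hstar, hz, hy, hyz.symm, h1, h2⟩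
end

section
/- Let D be a strongly connected digraph on n ≥ 5 vertices with minimum semi-degree at least 2 that satisfies condition (*) and contains no cycle of length n − 1. Let C = x₁x₂…x_{n−2}x₁ be a cycle of length n − 2 in D and let y, z be the two vertices of D not on C. If both arcs yz and zy belong to A(D) and d(y) = n, then n is even and D is isomorphic to K*_{n/2,n/2} or to K*_{n/2,n/2} minus one arc. -/
namespace PaperDG

open Finset

section helpers

variable {V : Type*}

structure Cfg (A : V → V → Prop) (m : ℕ) (f : ZMod m → V) (y z : V) : Prop where
  inj : Function.Injective f
  cyc : ∀ i, A (f i) (f (i + 1))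
  hy : ∀ i, y ≠ f i
  hz : ∀ i, z ≠ f i
  yz : y ≠ z

theorem Cfg.symm {A : V → V → Prop} {m : ℕ} {f : ZMod m → V} {y z : V} (c : Cfg A m f y z) :
    Cfg A m f z y := ⟨c.inj, c.cyc, c.hz, c.hy, c.yz.symm⟩

theorem mkcycle (A : V → V → Prop) (m : ℕ) (g : ℕ → V)
    (hinj : ∀ i j, i ≤ m → j ≤ m → g i = g j → i = j)
    (hc : ∀ i, i < m → A (g i) (g (i + 1))) (hl : A (g m) (g 0)) : HasCycle A (m + 1) := by
  refine ⟨fun i => g i.val, ?_, ?_⟩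
  · intro i j h
    apply ZMod.val_injective
    have hi := ZMod.val_lt i
    have hj := ZMod.val_lt j
    exact hinj _ _ (by omega) (by omega) h
  · intro i
    have hi := ZMod.val_lt i
    by_cases h : i.val + 1 < m + 1
    · have : (i + 1).val = i.val + 1 := by
        rw [ZMod.val_add, ZMod.val_one_eq_one_mod, Nat.add_mod_mod, Nat.mod_eq_of_lt h]
      simp only [this]
      exact hc _ (by omega)
    · have h' : i.val = m := by omega
      have : (i + 1).val = 0 := by
        rw [ZMod.val_add, ZMod.val_one_eq_one_mod, Nat.add_mod_mod, h', Nat.mod_self]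
      simp only [this, h']
      exact hl

theorem shift_inj {m : ℕ} {f : ZMod m → V} (hinj : Function.Injective f) (a : ZMod m)
    {i j : ℕ} (hi : i < m) (hj : j < m) (h : f (a + i) = f (a + j)) : i = j := by
  have h1 := add_left_cancel (hinj h)
  rw [ZMod.natCast_eq_natCast_iff'] at h1
  rwa [Nat.mod_eq_of_lt hi, Nat.mod_eq_of_lt hj] at h1

theorem noins {A : V → V → Prop} {m : ℕ} {f : ZMod m → V} {y z : V} (hm : 3 ≤ m)
    (hno : ¬HasCycle A (m + 1)) (c : Cfg A m f y z) (a : ZMod m) :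
    ¬(A (f a) y ∧ A y (f (a + 1))) := by
  rintro ⟨h1, h2⟩
  apply hno
  apply mkcycle A m (fun i => if i < m then f (a + 1 + (i : ℕ)) else y)
  · intro i j hi hj h
    by_cases h3 : i < m <;> by_cases h4 : j < m <;> simp only [h3, h4, if_true, if_false] at h
    · exact shift_inj c.inj _ h3 h4 h
    · exact absurd h.symm (c.hy _)
    · exact absurd h (c.hy _)
    · omega
  · intro i hi
    simp only [hi, if_true]
    split_ifs with h
    · have := c.cyc (a + 1 + (i : ℕ))
      push_cast
      rwa [← add_assoc]
    · have h' : ((i : ℕ) : ZMod m) + 1 = 0 := by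
        have : i + 1 = m := by omega
        have h5 : ((i + 1 : ℕ) : ZMod m) = 0 := by rw [this]; simp
        simpa using h5
      have : a + 1 + (i : ZMod m) = a := by linear_combination h'
      rw [this]; exact h1
  · simp only [lt_irrefl, if_false, show 0 < m by omega, if_true]
    simpa using h2

theorem noins2 {A : V → V → Prop} {m : ℕ} {f : ZMod m → V} {y z : V} (hm : 3 ≤ m)
    (hno : ¬HasCycle A (m + 1)) (c : Cfg A m f y z) (a : ZMod m) :
    ¬(A (f a) y ∧ A y z ∧ A z (f (a + 2))) := by
  rintro ⟨h1, h0, h2⟩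
  apply hno
  apply mkcycle A m (fun i => if i < m - 1 then f (a + 2 + (i : ℕ)) else if i < m then y else z)
  · intro i j hi hj h
    by_cases h3 : i < m - 1 <;> by_cases h4 : j < m - 1 <;> by_cases h5 : i < m <;>
      by_cases h6 : j < m <;> simp only [h3, h4, h5, h6, if_true, if_false] at h
    all_goals first
      | omega
      | exact shift_inj c.inj _ h5 h6 h
      | exact absurd h (c.hy _)
      | exact absurd h (c.hz _)
      | exact absurd h.symm (c.hy _)
      | exact absurd h.symm (c.hz _)
      | exact absurd h c.yz
      | exact absurd h.symm c.yz
  · intro i hi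
    simp only [hi, if_true]
    by_cases h3 : i + 1 < m - 1
    · have h4 : i < m - 1 := by omega
      simp only [h3, h4, if_true]
      have := c.cyc (a + 2 + (i : ℕ))
      push_cast
      rwa [← add_assoc]
    · by_cases h4 : i < m - 1
      · have h5 : i + 1 < m := by omega
        simp only [h3, h4, h5, if_true, if_false]
        have h' : ((i : ℕ) : ZMod m) + 2 = 0 := by
          have : i + 2 = m := by omega
          have h5 : ((i + 2 : ℕ) : ZMod m) = 0 := by rw [this]; simp
          simpa using h5
        have : a + 2 + (i : ZMod m) = a := by linear_combination h'
        rw [this]; exact h1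
      · have h5 : ¬ i + 1 < m := by omega
        simp only [h3, h4, h5, if_false]
        exact h0
  · have h4 : ¬ m < m - 1 := by omega
    simp only [lt_irrefl, if_false, show 0 < m - 1 by omega, if_true, h4]
    simpa using h2

theorem swap {A : V → V → Prop} {m : ℕ} {f : ZMod m → V} {y z : V} (hm : 3 ≤ m)
    (hirr : ∀ v, ¬A v v) (c : Cfg A m f y z) (k : ZMod m)
    (h1 : A (f (k - 1)) z) (h2 : A z (f (k + 1))) :
    Cfg A m (Function.update f k z) y (f k) := by
  have ne1 : ∀ i : ZMod m, i + 1 ≠ i := by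
    intro i h
    have := c.cyc i
    rw [h] at this
    exact hirr _ this
  refine ⟨?_, ?_, ?_, ?_, c.hy k⟩
  · intro i j h
    simp only [Function.update_apply] at h
    split_ifs at h with h3 h4 h4
    · rw [h3, h4]
    · exact absurd h (c.hz _)
    · exact absurd h.symm (c.hz _)
    · exact c.inj h
  · intro i
    simp only [Function.update_apply]
    split_ifs with h3 h4 h4
    · exact absurd (h4.trans h3.symm) (ne1 i)
    · rw [h3]; exact h2
    · have : i = k - 1 := by rw [← h4]; ring
      rw [this]; exact h1
    · exact c.cyc i
  · intro i
    simp only [Function.update_apply]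
    split_ifs
    · exact c.yz
    · exact c.hy i
  · intro i
    simp only [Function.update_apply]
    split_ifs with h
    · exact (c.hz k).symm
    · intro h3; exact h (c.inj h3).symm

theorem cyc_all {m : ℕ} [NeZero m] {S : ZMod m → Prop} (h : ∀ i, S i → S (i + 1)) {i0 : ZMod m}
    (h0 : S i0) (i : ZMod m) : S i := by
  have : ∀ k : ℕ, S (i0 + (k : ZMod m)) := by
    intro k
    induction k with
    | zero => simpa using h0
    | succ k ih =>
      have := h _ ih
      push_cast
      rwa [← add_assoc]
  have h2 := this (i - i0).val
  rw [ZMod.natCast_zmod_val] at h2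
  simpa using h2

variable [Fintype V]

open Classical in
theorem outDeg_eq_s9 (A : V → V → Prop) (v : V) : outDeg A v = #{w | A v w} := by
  unfold outDeg; rw [Nat.card_eq_fintype_card, Fintype.card_subtype]

open Classical in
theorem inDeg_eq_s9 (A : V → V → Prop) (v : V) : inDeg A v = #{w | A w v} := by
  unfold inDeg; rw [Nat.card_eq_fintype_card, Fintype.card_subtype]

open Classical in
theorem univ_eq {A : V → V → Prop} {m : ℕ} [NeZero m] {f : ZMod m → V} {y z : V}
    (hcard : Fintype.card V = m + 2) (c : Cfg A m f y z) :
    (univ : Finset V) = insert y (insert z (univ.image f)) := by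
  symm
  apply Finset.eq_univ_of_card
  have hz : z ∉ univ.image f := by
    simp only [mem_image, mem_univ, true_and, not_exists]
    intro i h; exact c.hz i h.symm
  have hy : y ∉ insert z (univ.image f) := by
    simp only [mem_insert, mem_image, mem_univ, true_and, not_or, not_exists]
    exact ⟨c.yz, fun i h => c.hy i h.symm⟩
  rw [card_insert_of_notMem hy, card_insert_of_notMem hz, card_image_of_injective _ c.inj,
    card_univ, ZMod.card, hcard]

theorem cover {A : V → V → Prop} {m : ℕ} [NeZero m] {f : ZMod m → V} {y z : V}
    (hcard : Fintype.card V = m + 2) (c : Cfg A m f y z) (v : V) :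
    v = y ∨ v = z ∨ ∃ i, v = f i := by
  classical
  have := mem_univ v
  rw [univ_eq hcard c] at this
  simp only [mem_insert, mem_image, mem_univ, true_and] at this
  rcases this with h | h | ⟨i, h⟩
  · exact Or.inl h
  · exact Or.inr (Or.inl h)
  · exact Or.inr (Or.inr ⟨i, h.symm⟩)

open Classical in
theorem sum_eq {A : V → V → Prop} {m : ℕ} [NeZero m] {f : ZMod m → V} {y z : V}
    (hcard : Fintype.card V = m + 2) (c : Cfg A m f y z) (F : V → ℕ) :
    ∑ v, F v = F y + (F z + ∑ i, F (f i)) := by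
  have hz : z ∉ univ.image f := by
    simp only [mem_image, mem_univ, true_and, not_exists]
    intro i h; exact c.hz i h.symm
  have hy : y ∉ insert z (univ.image f) := by
    simp only [mem_insert, mem_image, mem_univ, true_and, not_or, not_exists]
    exact ⟨c.yz, fun i h => c.hy i h.symm⟩
  rw [univ_eq hcard c, sum_insert hy, sum_insert hz, sum_image (fun a _ b _ h => c.inj h)]

open Classical in
theorem deg_eq {A : V → V → Prop} {m : ℕ} [NeZero m] {f : ZMod m → V} {y z : V}
    (hirr : ∀ v, ¬A v v)
    (hcard : Fintype.card V = m + 2) (c : Cfg A m f y z) :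
    deg A z = (if A z y then 1 else 0) + (if A y z then 1 else 0) +
      ∑ i, ((if A (f i) z then 1 else 0) + (if A z (f (i + 1)) then 1 else 0)) := by
  unfold deg
  rw [outDeg_eq_s9, inDeg_eq_s9, card_filter, card_filter, sum_eq hcard c, sum_eq hcard c,
    sum_add_distrib]
  have : ∑ i, (if A z (f (i + 1)) then 1 else 0) = ∑ i, (if A z (f i) then 1 else 0) :=
    Equiv.sum_comp (Equiv.addRight (1 : ZMod m)) (fun i => if A z (f i) then 1 else 0)
  rw [this]
  simp only [hirr, if_false]
  ring

theorem sum_bound {ι : Type*} [Fintype ι] [DecidableEq ι] (c : ι → ℕ) (h : ∀ i, c i ≤ 1)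
    (T : Finset ι) (hT : ∀ i ∈ T, c i = 0) : ∑ i, c i + #T ≤ Fintype.card ι := by
  have h1 : ∑ i, c i = ∑ i ∈ Tᶜ, c i := by
    rw [← sum_add_sum_compl T c, sum_eq_zero hT, zero_add]
  have h2 : ∑ i ∈ Tᶜ, c i ≤ ∑ i ∈ Tᶜ, 1 := sum_le_sum (fun i _ => h i)
  have h3 := card_compl_add_card T
  simp only [sum_const, smul_eq_mul, mul_one] at h2
  omega

open Classical in
theorem deg_bound {A : V → V → Prop} {m : ℕ} [NeZero m] {f : ZMod m → V} {y z : V}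
    (hm : 3 ≤ m) (hirr : ∀ v, ¬A v v) (hno : ¬HasCycle A (m + 1))
    (hcard : Fintype.card V = m + 2) (c : Cfg A m f y z) (T : Finset (ZMod m))
    (hT : ∀ i ∈ T, ¬A (f i) z ∧ ¬A z (f (i + 1))) :
    deg A z + #T ≤ m + 2 := by
  rw [deg_eq hirr hcard c]
  have := sum_bound (fun i => (if A (f i) z then 1 else 0) + (if A z (f (i + 1)) then 1 else 0))
    (fun i => by
      have := noins hm hno c.symm i
      split_ifs <;> simp_all) T (fun i hi => by simp [hT i hi])
  rw [ZMod.card] at this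
  split_ifs <;> omega

theorem deg_full {A : V → V → Prop} {m : ℕ} [NeZero m] {f : ZMod m → V} {y z : V}
    (hm : 3 ≤ m) (hirr : ∀ v, ¬A v v) (hno : ¬HasCycle A (m + 1))
    (hcard : Fintype.card V = m + 2) (c : Cfg A m f y z) (hd : deg A z = m + 2) (i : ZMod m) :
    A (f i) z ∨ A z (f (i + 1)) := by
  by_contra! h
  have := deg_bound hm hirr hno hcard c {i} (by simpa using h)
  simp at this
  omega

theorem deg_one {A : V → V → Prop} {m : ℕ} [NeZero m] {f : ZMod m → V} {y z : V}
    (hm : 3 ≤ m) (hirr : ∀ v, ¬A v v) (hno : ¬HasCycle A (m + 1))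
    (hcard : Fintype.card V = m + 2) (c : Cfg A m f y z) (hd : m + 1 ≤ deg A z) (i j : ZMod m)
    (hi : ¬A (f i) z ∧ ¬A z (f (i + 1))) (hj : ¬A (f j) z ∧ ¬A z (f (j + 1))) : i = j := by
  classical
  by_contra! h
  have := deg_bound hm hirr hno hcard c {i, j} (by
    intro k hk
    simp only [mem_insert, mem_singleton] at hk
    rcases hk with rfl | rfl <;> assumption)
  rw [card_pair h] at this
  omega

theorem exists_out_s9 {A : V → V → Prop} {m : ℕ} [NeZero m] {f : ZMod m → V} {y z : V}
    (hirr : ∀ v, ¬A v v) (hsemi : MinSemiDegreeGE A 2)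
    (hcard : Fintype.card V = m + 2) (c : Cfg A m f y z) : ∃ i, A z (f i) := by
  classical
  by_contra! h
  have h1 := (hsemi z).1
  rw [outDeg_eq_s9] at h1
  have : ({w | A z w} : Finset V) ⊆ {y} := by
    intro v hv
    simp only [mem_filter, mem_univ, true_and, mem_singleton] at hv ⊢
    rcases cover hcard c v with h2 | h2 | ⟨i, h2⟩
    · exact h2
    · rw [h2] at hv; exact absurd hv (hirr z)
    · rw [h2] at hv; exact absurd hv (h i)
  have := card_le_card this
  simp at this
  omega

theorem exists_in_s9 {A : V → V → Prop} {m : ℕ} [NeZero m] {f : ZMod m → V} {y z : V}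
    (hirr : ∀ v, ¬A v v) (hsemi : MinSemiDegreeGE A 2)
    (hcard : Fintype.card V = m + 2) (c : Cfg A m f y z) : ∃ i, A (f i) z := by
  classical
  by_contra! h
  have h1 := (hsemi z).2
  rw [inDeg_eq_s9] at h1
  have : ({w | A w z} : Finset V) ⊆ {y} := by
    intro v hv
    simp only [mem_filter, mem_univ, true_and, mem_singleton] at hv ⊢
    rcases cover hcard c v with h2 | h2 | ⟨i, h2⟩
    · exact h2
    · rw [h2] at hv; exact absurd hv (hirr z)
    · rw [h2] at hv; exact absurd hv (h i)
  have := card_le_card this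
  simp at this
  omega

section main
variable {A : V → V → Prop} {m : ℕ} [NeZero m] {f : ZMod m → V} {y z : V}

/-- `x_i → z` gives `x_{i+1} → y`. -/
theorem nbr_in
    (hm : 3 ≤ m) (hirr : ∀ v, ¬A v v) (hno : ¬HasCycle A (m + 1))
    (hcard : Fintype.card V = m + 2) (c : Cfg A m f y z) (hdy : deg A y = m + 2)
    (h2 : A z y) (i : ZMod m) (h : A (f i) z) : A (f (i + 1)) y := by
  rcases deg_full hm hirr hno hcard c.symm hdy (i + 1) with h3 | h3
  · exact h3
  · rw [add_assoc, one_add_one_eq_two] at h3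
    exact absurd ⟨h, h2, h3⟩ (noins2 hm hno c.symm i)

/-- `z → x_{i+2}` gives not `x_i → y`, and `y → x_{i+1}`. -/
theorem nbr_out
    (hm : 3 ≤ m) (hirr : ∀ v, ¬A v v) (hno : ¬HasCycle A (m + 1))
    (hcard : Fintype.card V = m + 2) (c : Cfg A m f y z) (hdy : deg A y = m + 2)
    (h1 : A y z) (i : ZMod m) (h : A z (f (i + 2))) :
    ¬A (f i) y ∧ A y (f (i + 1)) := by
  have h3 : ¬A (f i) y := fun h3 => noins2 hm hno c i ⟨h3, h1, h⟩
  exact ⟨h3, (deg_full hm hirr hno hcard c.symm hdy i).resolve_left h3⟩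

theorem step1
    (hm : 3 ≤ m) (hirr : ∀ v, ¬A v v) (hno : ¬HasCycle A (m + 1))
    (hsemi : MinSemiDegreeGE A 2) (hstar : CondStar A)
    (hcard : Fintype.card V = m + 2) (c : Cfg A m f y z) (hdy : deg A y = m + 2)
    (h1 : A y z) : m + 1 ≤ deg A z := by
  by_contra! hlt
  obtain ⟨l, hl⟩ := exists_out_s9 hirr hsemi hcard c
  obtain ⟨q, hq⟩ := exists_in_s9 hirr hsemi hcard c
  have key : ∀ i, A z (f (-i)) → A z (f (-(i + 1))) := by
    intro i hi
    have e1 : -i = (-i - 2) + 2 := by ring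
    have e2 : -(i + 1) = (-i - 2) + 1 := by ring
    have h3 := (nbr_out hm hirr hno hcard c hdy h1 (-i - 2) (by rwa [← e1])).2
    rw [← e2] at h3
    have h4 : ¬A (f (-(i + 1))) z := fun h4 =>
      noins hm hno c.symm (-(i + 1)) ⟨h4, by rwa [show -(i + 1) + 1 = -i by ring]⟩
    by_contra h5
    have := (hstar z (f (-(i + 1))) (c.hz _) h5 h4 ⟨y, h1, h3⟩).2
    rw [hcard] at this
    have := this.trans (min_le_left _ _)
    omega
  have h6 := cyc_all (S := fun i => A z (f (-i))) key (i0 := -l) (by simpa using hl) (-(q + 1))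
  simp only [neg_neg] at h6
  exact noins hm hno c.symm q ⟨hq, h6⟩

theorem step2
    (hm : 3 ≤ m) (hirr : ∀ v, ¬A v v) (hno : ¬HasCycle A (m + 1))
    (hsemi : MinSemiDegreeGE A 2) (hstar : CondStar A)
    (hcard : Fintype.card V = m + 2) (c : Cfg A m f y z) (hdy : deg A y = m + 2)
    (h1 : A y z) (h2 : A z y) : ∃ k, A (f (k - 1)) z ∧ A z (f (k + 1)) := by
  by_contra! hne
  have hd := step1 hm hirr hno hsemi hstar hcard c hdy h1
  obtain ⟨l, hl⟩ := exists_out_s9 hirr hsemi hcard c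
  obtain ⟨q, hq⟩ := exists_in_s9 hirr hsemi hcard c
  have hne' : ∀ i, A (f i) z → ¬A z (f (i + 1 + 1)) := by
    intro i hi
    exact hne (i + 1) (by simpa using hi)
  have hl' : ¬A (f (l - 1)) z := fun h => noins hm hno c.symm (l - 1) ⟨h, by simpa using hl⟩
  -- there is a position where the run of in-neighbours stops
  have : ∃ i, A (f i) z ∧ ¬A (f (i + 1)) z := by
    by_contra! h
    exact hl' (cyc_all (S := fun i => A (f i) z) h hq (l - 1))
  obtain ⟨b, hb1, hb2⟩ := this
  have hb3 : ¬A (f (b + 1)) z ∧ ¬A z (f (b + 1 + 1)) := ⟨hb2, hne' b hb1⟩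
  have hP : A (f (b + 1)) y := nbr_in hm hirr hno hcard c hdy h2 b hb1
  have hZ : ¬A z (f (b + 1 + 1 + 1)) := by
    intro h
    exact (nbr_out hm hirr hno hcard c hdy h1 (b + 1)
      (by rwa [show b + 1 + 2 = b + 1 + 1 + 1 by ring])).1 hP
  -- from b+2 on, everything is an in-neighbour unless it is b+1
  have hQ : A (f (b + 1 + 1)) z := by
    by_contra h
    have := deg_one hm hirr hno hcard c hd _ _ ⟨h, hZ⟩ hb3
    have h7 := c.cyc (b + 1)
    rw [this] at h7
    exact hirr _ h7
  have hall := cyc_all (S := fun i => A (f i) z ∨ i = b + 1) (i0 := b + 1 + 1) (by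
    rintro i (h | rfl)
    · by_contra! h3
      exact h3.2 (deg_one hm hirr hno hcard c hd _ _ ⟨h3.1, hne' i h⟩ hb3)
    · exact Or.inl hQ) (Or.inl hQ) (l - 1)
  rcases hall with h | h
  · exact hl' h
  · apply hb3.2
    rw [← h]; simpa using hl

theorem step3
    (hm : 3 ≤ m) (hirr : ∀ v, ¬A v v) (hno : ¬HasCycle A (m + 1))
    (hsemi : MinSemiDegreeGE A 2) (hstar : CondStar A)
    (hcard : Fintype.card V = m + 2) (c : Cfg A m f y z) (hdy : deg A y = m + 2)
    (h1 : A y z) (h2 : A z y) :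
    ∃ (g : ZMod m → V) (w : V), Cfg A m g y w ∧ A y w ∧ A w y ∧ deg A w = m + 2 := by
  have hd := step1 hm hirr hno hsemi hstar hcard c hdy h1
  have hd' := deg_bound hm hirr hno hcard c ∅ (by simp)
  simp only [card_empty, add_zero] at hd'
  by_cases hdz : deg A z = m + 2
  · exact ⟨f, z, c, h1, h2, hdz⟩
  obtain ⟨k, hk1, hk2⟩ := step2 hm hirr hno hsemi hstar hcard c hdy h1 h2
  have hP : A (f k) y := by
    simpa using nbr_in hm hirr hno hcard c hdy h2 _ hk1
  have hY : A y (f k) := by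
    have := (nbr_out hm hirr hno hcard c hdy h1 (k - 1)
      (by rwa [show k - 1 + 2 = k + 1 by ring])).2
    simpa using this
  have hc := swap hm hirr c k hk1 hk2
  refine ⟨_, f k, hc, hY, hP, ?_⟩
  have hb := deg_bound hm hirr hno hcard hc ∅ (by simp)
  simp only [card_empty, add_zero] at hb
  have n1 : ¬A z (f k) := fun h => noins hm hno c.symm (k - 1) ⟨hk1, by simpa using h⟩
  have n2 : ¬A (f k) z := fun h => noins hm hno c.symm k ⟨h, hk2⟩
  have := (hstar z (f k) (c.hz k) n1 n2 ⟨y, h1, hY⟩).1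
  rw [hcard] at this
  omega

end main

theorem finish (A : V → V → Prop) (hirr : ∀ v, ¬A v v) (n : ℕ) (hcard : Fintype.card V = n)
    (S : Finset V) (hS : 2 * #S = n)
    (hT : ∀ t, t ∉ S → ∀ v, A t v ∨ A v t → v ∈ S)
    (hd : ∀ t, t ∉ S → n - 1 ≤ deg A t)
    (hdd : ∀ t, t ∉ S → ∀ t', t' ∉ S → t ≠ t' → 2 * n - 1 ≤ deg A t + deg A t')
    (hs : ∀ s ∈ S, deg A s ≤ n) :
    Even (Fintype.card V) ∧ (IsKhalf A ∨ IsKhalfMinusArc A) := by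
  classical
  have hSc : #Sᶜ = #S := by
    have := card_compl_add_card S
    omega
  have hSc' : 2 * Nat.card (↑S : Set V) = Fintype.card V := by
    rw [Nat.card_eq_fintype_card, hcard, ← hS]; simp
  refine ⟨⟨#S, by omega⟩, ?_⟩
  have hpos : ∀ s ∈ S, 1 ≤ #S := fun s h => card_pos.mpr ⟨s, h⟩
  have osub : ∀ t, t ∉ S → ({w | A t w} : Finset V) ⊆ S := by
    intro t ht v hv
    exact hT t ht v (Or.inl (by simpa using hv))
  have isub : ∀ t, t ∉ S → ({w | A w t} : Finset V) ⊆ S := by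
    intro t ht v hv
    exact hT t ht v (Or.inr (by simpa using hv))
  have oC : ∀ t, t ∉ S → outDeg A t ≤ #S := by
    intro t ht; rw [outDeg_eq_s9]; exact card_le_card (osub t ht)
  have iC : ∀ t, t ∉ S → inDeg A t ≤ #S := by
    intro t ht; rw [inDeg_eq_s9]; exact card_le_card (isub t ht)
  have oM : ∀ t, t ∉ S → ∀ s ∈ S, ¬A t s → outDeg A t + 1 ≤ #S := by
    intro t ht s hs h; rw [outDeg_eq_s9]
    apply card_lt_card
    refine (ssubset_iff_of_subset (osub t ht)).2 ⟨s, hs, by simpa using h⟩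
  have iM : ∀ t, t ∉ S → ∀ s ∈ S, ¬A s t → inDeg A t + 1 ≤ #S := by
    intro t ht s hs h; rw [inDeg_eq_s9]
    apply card_lt_card
    refine (ssubset_iff_of_subset (isub t ht)).2 ⟨s, hs, by simpa using h⟩
  have oMM : ∀ t, t ∉ S → ∀ s ∈ S, ∀ s' ∈ S, s ≠ s' → ¬A t s → ¬A t s' →
      outDeg A t + 2 ≤ #S := by
    intro t ht s hs s' hs' hne h h'; rw [outDeg_eq_s9, ← card_pair hne, ← card_union_of_disjoint]
    · apply card_le_card
      apply union_subset (osub t ht)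
      intro v; simp only [mem_insert, mem_singleton]; rintro (rfl | rfl) <;> assumption
    · rw [disjoint_left]; intro v; simp only [mem_filter, mem_univ, true_and, mem_insert, mem_singleton]
      rintro hv (rfl | rfl) <;> contradiction
  have iMM : ∀ t, t ∉ S → ∀ s ∈ S, ∀ s' ∈ S, s ≠ s' → ¬A s t → ¬A s' t →
      inDeg A t + 2 ≤ #S := by
    intro t ht s hs s' hs' hne h h'; rw [inDeg_eq_s9, ← card_pair hne, ← card_union_of_disjoint]
    · apply card_le_card
      apply union_subset (isub t ht)
      intro v; simp only [mem_insert, mem_singleton]; rintro (rfl | rfl) <;> assumption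
    · rw [disjoint_left]; intro v; simp only [mem_filter, mem_univ, true_and, mem_insert, mem_singleton]
      rintro hv (rfl | rfl) <;> contradiction
  have hdM : ∀ t, t ∉ S → ∀ s ∈ S, (¬A t s ∨ ¬A s t) → deg A t + 1 ≤ n := by
    intro t ht s hs h
    have := oC t ht
    have := iC t ht
    unfold deg
    rcases h with h | h
    · have := oM t ht s hs h; omega
    · have := iM t ht s hs h; omega
  -- the missing arcs
  have hteq : ∀ t t' s s', t ∉ S → t' ∉ S → s ∈ S → s' ∈ S → (¬A t s ∨ ¬A s t) →
      (¬A t' s' ∨ ¬A s' t') → t = t' := by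
    intro t t' s s' ht ht' hs hs' h h'
    by_contra hne
    have := hdd t ht t' ht' hne
    have := hdM t ht s hs h
    have := hdM t' ht' s' hs' h'
    omega
  have huniq : ∀ a b a' b', (a ∈ S ↔ b ∉ S) → (a' ∈ S ↔ b' ∉ S) → ¬A a b → ¬A a' b' →
      a = a' ∧ b = b' := by
    intro a b a' b' h h' hA hA'
    by_cases ha : a ∈ S <;> by_cases ha' : a' ∈ S
    · have hb := h.1 ha
      have hb' := h'.1 ha'
      have e := hteq b b' a a' hb hb' ha ha' (Or.inr hA) (Or.inr hA')
      subst e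
      refine ⟨?_, rfl⟩
      by_contra hne
      have := iMM b hb a ha a' ha' hne hA hA'
      have := oC b hb
      have := hd b hb
      unfold deg at this
      omega
    · exfalso
      have hb := h.1 ha
      have hb' : b' ∈ S := by tauto
      have e := hteq b a' a b' hb ha' ha hb' (Or.inr hA) (Or.inl hA')
      subst e
      have := iM b hb a ha hA
      have := oM b hb b' hb' hA'
      have := hd b hb
      unfold deg at this
      omega
    · exfalso
      have hb' := h'.1 ha'
      have hb : b ∈ S := by tauto
      have e := hteq a b' b a' ha hb' hb ha' (Or.inl hA) (Or.inr hA')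
      subst e
      have := oM a ha b hb hA
      have := iM a ha a' ha' hA'
      have := hd a ha
      unfold deg at this
      omega
    · have hb : b ∈ S := by tauto
      have hb' : b' ∈ S := by tauto
      have e := hteq a a' b b' ha ha' hb hb' (Or.inl hA) (Or.inl hA')
      subst e
      refine ⟨rfl, ?_⟩
      by_contra hne
      have := oMM a ha b hb b' hb' hne hA hA'
      have := iC a ha
      have := hd a ha
      unfold deg at this
      omega
  -- independence of S
  have hfull : ∀ s ∈ S, (∀ t, t ∉ S → A s t ∧ A t s) → ∀ v ∈ S, ¬A s v ∧ ¬A v s := by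
    intro s hsS hf v hv
    have h1 : Sᶜ ⊆ ({w | A s w} : Finset V) := by
      intro t ht; simp only [mem_filter, mem_univ, true_and]; exact (hf t (by simpa using ht)).1
    have h2 : Sᶜ ⊆ ({w | A w s} : Finset V) := by
      intro t ht; simp only [mem_filter, mem_univ, true_and]; exact (hf t (by simpa using ht)).2
    have c1 := card_le_card h1
    have c2 := card_le_card h2
    have h3 := hs s hsS
    unfold deg at h3
    rw [outDeg_eq_s9, inDeg_eq_s9] at h3
    constructor
    · intro h
      have : #Sᶜ < #({w | A s w} : Finset V) := card_lt_card
        ((ssubset_iff_of_subset h1).2 ⟨v, by simpa using h, by simpa using hv⟩)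
      omega
    · intro h
      have : #Sᶜ < #({w | A w s} : Finset V) := card_lt_card
        ((ssubset_iff_of_subset h2).2 ⟨v, by simpa using h, by simpa using hv⟩)
      omega
  have hind : ∀ s ∈ S, ∀ v ∈ S, ¬A s v := by
    intro s hsS v hv hA
    by_cases h1 : ∀ t, t ∉ S → A s t ∧ A t s
    · exact (hfull s hsS h1 v hv).1 hA
    by_cases h2 : ∀ t, t ∉ S → A v t ∧ A t v
    · exact (hfull v hv h2 s hsS).2 hA
    push Not at h1 h2
    obtain ⟨t, ht, h1⟩ := h1
    obtain ⟨t', ht', h2⟩ := h2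
    have hne : s ≠ v := fun h => hirr v (by rwa [h] at hA)
    by_cases k1 : A s t <;> by_cases k2 : A v t'
    · have := huniq t s t' v (by tauto) (by tauto) (h1 k1) (h2 k2)
      exact hne this.2
    · have := huniq t s v t' (by tauto) (by tauto) (h1 k1) k2
      exact ht (this.1 ▸ hv)
    · have := huniq s t t' v (by tauto) (by tauto) k1 (h2 k2)
      exact ht' (this.1 ▸ hsS)
    · have := huniq s t v t' (by tauto) (by tauto) k1 k2
      exact hne this.1
  have hopp : ∀ u v, A u v → (u ∈ S ↔ v ∉ S) := by
    intro u v h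
    by_cases hu : u ∈ S
    · have : v ∉ S := fun hv => hind u hu v hv h
      tauto
    · have := hT u hu v (Or.inl h)
      tauto
  by_cases hM : ∃ a b, (a ∈ S ↔ b ∉ S) ∧ ¬A a b
  · right
    obtain ⟨a, b, hab, hA⟩ := hM
    refine ⟨↑S, a, b, hSc', by simpa using hab, ?_⟩
    intro u v
    simp only [mem_coe]
    constructor
    · intro h
      refine ⟨hopp u v h, ?_⟩
      rintro ⟨rfl, rfl⟩; exact hA h
    · rintro ⟨h, h'⟩
      by_contra hn
      exact h' (huniq u v a b h hab hn hA)
  · left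
    push Not at hM
    refine ⟨↑S, hSc', ?_⟩
    intro u v
    simp only [mem_coe]
    exact ⟨hopp u v, hM u v⟩

section main2
variable {A : V → V → Prop} {m : ℕ} [NeZero m] {f : ZMod m → V} {y z : V}

theorem step4
    (hm : 3 ≤ m) (hirr : ∀ v, ¬A v v) (hno : ¬HasCycle A (m + 1))
    (hsemi : MinSemiDegreeGE A 2) (hstar : CondStar A)
    (hcard : Fintype.card V = m + 2) (c : Cfg A m f y z) (hdy : deg A y = m + 2)
    (h1 : A y z) (h2 : A z y) (hdz : deg A z = m + 2) :
    Even (Fintype.card V) ∧ (IsKhalf A ∨ IsKhalfMinusArc A) := by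
  classical
  have fullY := deg_full hm hirr hno hcard c.symm hdy
  have fullZ := deg_full hm hirr hno hcard c hdz
  have nY := noins hm hno c
  have nin := nbr_in hm hirr hno hcard c hdy h2
  have nout := nbr_out hm hirr hno hcard c hdy h1
  have P2 : ∀ i, A (f i) y → A (f (i + 1)) z := by
    intro i hi
    refine (fullZ (i + 1)).resolve_right fun h => ?_
    rw [add_assoc, one_add_one_eq_two] at h
    exact (nout i h).1 hi
  have P2' : ∀ i, A (f i) y → A (f (i + 2)) y := by
    intro i hi
    have := nin _ (P2 i hi)
    rwa [add_assoc, one_add_one_eq_two] at this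
  have P2iff : ∀ i, A (f (i + 2)) y → A (f i) y := by
    intro i hi
    have : ∀ k : ℕ, A (f (i + 2 + 2 * (k : ZMod m))) y := by
      intro k
      induction k with
      | zero => simpa using hi
      | succ k ih =>
        have := P2' _ ih
        push_cast
        rwa [show i + 2 + 2 * ((k : ZMod m) + 1) = i + 2 + 2 * (k : ZMod m) + 2 by ring]
    have h := this (-1 : ZMod m).val
    rw [ZMod.natCast_zmod_val] at h
    rwa [show i + 2 + 2 * (-1 : ZMod m) = i by ring] at h
  obtain ⟨p, hp⟩ := exists_in_s9 hirr hsemi hcard c.symm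
  obtain ⟨q, hq⟩ := exists_out_s9 hirr hsemi hcard c.symm
  have hq' : ¬A (f (q - 1)) y := fun h => nY (q - 1) ⟨h, by simpa using hq⟩
  have alt : ∀ i, A (f (i + 1)) y ↔ ¬A (f i) y := by
    intro i
    constructor
    · intro ha hb
      have := cyc_all (S := fun i => A (f i) y ∧ A (f (i + 1)) y) (i0 := i) (by
        rintro j ⟨hj1, hj2⟩
        refine ⟨hj2, ?_⟩
        have := P2' j hj1
        rwa [add_assoc, one_add_one_eq_two]) ⟨hb, ha⟩ (q - 1)
      exact hq' this.1
    · intro hb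
      by_contra ha
      have := cyc_all (S := fun i => ¬A (f i) y ∧ ¬A (f (i + 1)) y) (i0 := i) (by
        rintro j ⟨hj1, hj2⟩
        refine ⟨hj2, ?_⟩
        intro h
        rw [add_assoc, one_add_one_eq_two] at h
        exact hj1 (P2iff j h)) ⟨hb, ha⟩ p
      exact this.1 hp
  have alt' : ∀ i, A (f (i - 1)) y ↔ ¬A (f i) y := by
    intro i
    have := alt (i - 1)
    rw [sub_add_cancel] at this
    tauto
  -- y and f k for P k
  have Yk : ∀ k, A (f k) y → A y (f k) := by
    intro k hk
    have := (fullY (k - 1)).resolve_left (by rw [alt']; exact fun h => h hk)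
    simpa using this
  have swapT : ∀ k, A (f k) y → Cfg A m (Function.update f k z) y (f k) := by
    intro k hk
    have h3 : A (f (k - 1)) z := by
      have := P2 (k - 2) (by
        by_contra h
        apply h
        apply P2iff
        simpa using hk)
      rwa [show k - 2 + 1 = k - 1 by ring] at this
    refine swap hm hirr c k h3 ?_
    refine (fullZ k).resolve_left fun h => ?_
    have := nin k h
    rw [alt] at this
    exact this hk
  have PT : ∀ k, A (f k) y → ∀ i, A (Function.update f k z i) y ↔ A (f i) y := by
    intro k hk i
    rw [Function.update_apply]
    split_ifs with h
    · rw [h]; exact ⟨fun _ => hk, fun _ => h2⟩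
    · rfl
  let S : Finset V := insert y (image f {i | ¬A (f i) y})
  have memS : ∀ v, v ∈ S ↔ v = y ∨ ∃ i, ¬A (f i) y ∧ f i = v := by
    intro v; simp [S]
  have fS : ∀ i, f i ∈ S ↔ ¬A (f i) y := by
    intro i
    rw [memS]
    constructor
    · rintro (h | ⟨j, hj, h⟩)
      · exact absurd h.symm (c.hy i)
      · rwa [← h]
    · intro h; exact Or.inr ⟨i, h, rfl⟩
  have yS : y ∈ S := by rw [memS]; exact Or.inl rfl
  have zS : z ∉ S := by
    rw [memS]
    rintro (h | ⟨j, hj, h⟩)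
    · exact c.yz h.symm
    · exact c.hz j h.symm
  have caseT : ∀ t, t ∉ S → t = z ∨ ∃ k, t = f k ∧ A (f k) y := by
    intro t ht
    rcases cover hcard c t with rfl | rfl | ⟨i, rfl⟩
    · exact absurd yS ht
    · exact Or.inl rfl
    · rw [fS, not_not] at ht
      exact Or.inr ⟨i, rfl, ht⟩
  have hcS : 2 * #S = m + 2 := by
    have e1 : #S = #({i | ¬A (f i) y} : Finset (ZMod m)) + 1 := by
      rw [card_insert_of_notMem, card_image_of_injective _ c.inj]
      simp only [mem_image, not_exists, not_and]
      intro i _ h; exact c.hy i h.symm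
    have e2 : #({i | ¬A (f i) y} : Finset (ZMod m)) = #({i | A (f i) y} : Finset (ZMod m)) := by
      apply card_bij (fun i _ => i + 1)
      · intro i hi
        simp only [mem_filter, mem_univ, true_and] at hi ⊢
        rwa [alt]
      · intro i _ j _ h; exact add_right_cancel h
      · intro i hi
        simp only [mem_filter, mem_univ, true_and] at hi
        refine ⟨i - 1, ?_, by ring⟩
        simp only [mem_filter, mem_univ, true_and]
        rw [alt']; exact fun h => h hi
    have e3 := card_filter_add_card_filter_not (s := (univ : Finset (ZMod m))) (fun i => A (f i) y)
    rw [card_univ, ZMod.card] at e3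
    omega
  have hT : ∀ t, t ∉ S → ∀ v, A t v ∨ A v t → v ∈ S := by
    intro t ht v hv
    rcases caseT t ht with rfl | ⟨k, rfl, hk⟩
    · rcases cover hcard c v with rfl | rfl | ⟨i, rfl⟩
      · exact yS
      · simp [hirr] at hv
      · rw [fS]
        rcases hv with hv | hv
        · have := (nout (i - 2) (by simpa using hv)).1
          intro h
          apply this
          apply P2iff; simpa using h
        · have := nin i hv
          rwa [alt] at this
    · have c' := swapT k hk
      have hP' := PT k hk
      have main : ∀ i, (A (f k) (Function.update f k z i) ∨ A (Function.update f k z i) (f k)) →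
          ¬A (f i) y := by
        intro i hi
        rcases hi with hi | hi
        · have := (nbr_out hm hirr hno hcard c' hdy (Yk k hk) (i - 2) (by simpa using hi)).1
          rw [hP'] at this
          intro h
          apply this
          apply P2iff; simpa using h
        · have := nbr_in hm hirr hno hcard c' hdy hk i hi
          rwa [hP', alt] at this
      rcases cover hcard c' v with rfl | rfl | ⟨i, rfl⟩
      · exact yS
      · simp [hirr] at hv
      · have h5 := main i hv
        rw [Function.update_apply]
        split_ifs with h
        · rw [h] at h5; exact absurd hk h5
        · rwa [fS]
  have yT : ∀ t, t ∉ S → A y t := by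
    intro t ht
    rcases caseT t ht with rfl | ⟨k, rfl, hk⟩
    · exact h1
    · exact Yk k hk
  refine finish A hirr (m + 2) hcard S hcS hT ?_ ?_ ?_
  · intro t ht
    rcases caseT t ht with rfl | ⟨k, rfl, hk⟩
    · omega
    · have := step1 hm hirr hno hsemi hstar hcard (swapT k hk) hdy (Yk k hk)
      omega
  · intro t ht t' ht' hne
    have := (hstar t t' hne (fun h => ht' (hT t ht _ (Or.inl h)))
      (fun h => ht' (hT t ht _ (Or.inr h))) ⟨y, yT t ht, yT t' ht'⟩).1
    rwa [hcard] at this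
  · intro s hs
    rw [memS] at hs
    rcases hs with rfl | ⟨j, hj, rfl⟩
    · omega
    · have c' := swap hm hirr c.symm j ((alt' j).2 hj) ((fullY j).resolve_left hj)
      have := deg_bound hm hirr hno hcard c' ∅ (by simp)
      simpa using this

end main2

end helpers

end PaperDG

open PaperDG

/-- Claim 7. -/
theorem darbinyan_karapetyan_claim7 {V : Type*} [Fintype V] (A : V → V → Prop)
    (hirr : ∀ v : V, ¬A v v)
    (hn : 5 ≤ Fintype.card V)
    (hstrong : IsStrong A)
    (hsemi : MinSemiDegreeGE A 2)
    (hstar : CondStar A)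
    (hnoCn1 : ¬HasCycle A (Fintype.card V - 1))
    (x : ℕ → V)
    (hper : ∀ i : ℕ, x (i + (Fintype.card V - 2)) = x i)
    (hinjC : ∀ i j : ℕ, i < Fintype.card V - 2 → j < Fintype.card V - 2 → x i = x j → i = j)
    (hcyc : ∀ i : ℕ, A (x i) (x (i + 1)))
    (y z : V) (hyz : y ≠ z)
    (hy : ∀ i : ℕ, y ≠ x i) (hz : ∀ i : ℕ, z ≠ x i)
    (h1 : A y z) (h2 : A z y)
    (h3 : deg A y = Fintype.card V) :
    Even (Fintype.card V) ∧ (IsKhalf A ∨ IsKhalfMinusArc A) := by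
  obtain ⟨m, hcard⟩ : ∃ m, Fintype.card V = m + 2 := ⟨Fintype.card V - 2, by omega⟩
  have hm : 3 ≤ m := by omega
  have e1 : Fintype.card V - 1 = m + 1 := by omega
  have e2 : Fintype.card V - 2 = m := by omega
  rw [e1] at hnoCn1
  rw [e2] at hper hinjC
  haveI : NeZero m := ⟨by omega⟩
  have c : Cfg A m (fun i : ZMod m => x i.val) y z := by
    refine ⟨?_, ?_, fun i => hy _, fun i => hz _, hyz⟩
    · intro i j h
      exact ZMod.val_injective m (hinjC _ _ (ZMod.val_lt i) (ZMod.val_lt j) h)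
    · intro i
      have hi := ZMod.val_lt i
      have h := hcyc i.val
      have hv : (i + 1).val = (i.val + 1) % m := by
        rw [ZMod.val_add, ZMod.val_one_eq_one_mod, Nat.add_mod_mod]
      rw [hv]
      by_cases hlt : i.val + 1 < m
      · rwa [Nat.mod_eq_of_lt hlt]
      · have : i.val + 1 = m := by omega
        rw [this] at h ⊢
        rw [Nat.mod_self]
        have h0 := hper 0
        rw [zero_add] at h0
        rwa [h0] at h
  have hdy : deg A y = m + 2 := h3.trans hcard
  obtain ⟨g, w, cw, hw1, hw2, hdw⟩ := step3 hm hirr hnoCn1 hsemi hstar hcard c hdy h1 h2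
  exact step4 hm hirr hnoCn1 hsemi hstar hcard cw hdy hw1 hw2 hdw
end

section
/- Let D be a digraph on n ≥ 3 vertices containing a cycle C_m = x₁x₂…x_m x₁ with 2 ≤ m ≤ n − 1, and let x be a vertex not on this cycle. If the total number of arcs between x and the vertices of C_m is at least m + 1, then D contains a cycle of length k for every k with 2 ≤ k ≤ m + 1. -/
open PaperDG

/-- Lemma 1 (Häggkvist–Thomassen).  The cycle `C_m = x₁…x_m x₁` is encoded by an
`m`-periodic map `c : ℕ → V` injective on `[0, m)`; `d(x, C_m)` is the number of arcs
between `x` and the cycle, counting each direction separately. -/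
theorem haggkvist_thomassen_lemma1 {V : Type*} [Fintype V] (A : V → V → Prop)
    (hirr : ∀ v : V, ¬A v v)
    (hn : 3 ≤ Fintype.card V)
    (m : ℕ) (hm2 : 2 ≤ m) (hm : m ≤ Fintype.card V - 1)
    (c : ℕ → V)
    (hper : ∀ i : ℕ, c (i + m) = c i)
    (hinjC : ∀ i j : ℕ, i < m → j < m → c i = c j → i = j)
    (hcyc : ∀ i : ℕ, A (c i) (c (i + 1)))
    (x : V) (hx : ∀ i : ℕ, x ≠ c i)
    (hdeg : m + 1 ≤ Nat.card {i : ℕ // i < m ∧ A x (c i)} +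
                    Nat.card {i : ℕ // i < m ∧ A (c i) x}) :
    ∀ k : ℕ, 2 ≤ k → k ≤ m + 1 → HasCycle A k := by
  intro k hk hkm
  have hmod : ∀ j, c j = c (j % m) := by
    intro j
    have h : ∀ q r, c (r + m * q) = c r := by
      intro q
      induction q with
      | zero => intro r; simp
      | succ q ih => intro r; rw [Nat.mul_succ, ← Nat.add_assoc, hper, ih]
    conv_lhs => rw [← Nat.mod_add_div j m]
    exact h _ _
  have hcancel : ∀ i a b : ℕ, a < m → b < m → (i + a) % m = (i + b) % m → a = b := by
    intro i a b ha hb h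
    have h2 : a ≡ b [MOD m] := Nat.ModEq.add_left_cancel' i h
    exact Nat.ModEq.eq_of_lt_of_lt h2 ha hb
  have hwin : ∀ i a b : ℕ, a < m → b < m → c (i + a) = c (i + b) → a = b := by
    intro i a b ha hb h
    rw [hmod (i + a), hmod (i + b)] at h
    exact hcancel i a b ha hb
      (hinjC _ _ (Nat.mod_lt _ (by omega)) (Nat.mod_lt _ (by omega)) h)
  obtain ⟨i, hi1, hi2⟩ : ∃ i, A x (c i) ∧ A (c (i + (k - 2))) x := by
    classical
    by_contra hno
    push Not at hno
    let P := (Finset.range m).filter (fun i => A x (c i))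
    let Q := (Finset.range m).filter (fun i => A (c i) x)
    have hP : Nat.card {i : ℕ // i < m ∧ A x (c i)} = P.card := by
      exact Nat.subtype_card P (by simp [P])
    have hQ : Nat.card {i : ℕ // i < m ∧ A (c i) x} = Q.card := by
      exact Nat.subtype_card Q (by simp [Q])
    let R := P.image (fun i => (i + (k - 2)) % m)
    have hR : R.card = P.card := by
      apply Finset.card_image_of_injOn
      intro a ha b hb hab
      simp only [P, Finset.coe_filter, Finset.mem_range, Set.mem_setOf_eq] at ha hb
      apply hcancel (k - 2) a b ha.1 hb.1
      simpa [Nat.add_comm] using hab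
    have hdisj : Disjoint R Q := by
      rw [Finset.disjoint_left]
      intro j hj hq
      simp only [R, P, Q, Finset.mem_image, Finset.mem_filter, Finset.mem_range] at hj hq
      obtain ⟨i, hi, rfl⟩ := hj
      rw [← hmod] at hq
      exact hno i hi.2 hq.2
    have hsub : R ∪ Q ⊆ Finset.range m := by
      intro j hj
      simp only [R, Q, Finset.mem_union, Finset.mem_image, Finset.mem_filter,
        Finset.mem_range] at hj ⊢
      rcases hj with ⟨i, _, rfl⟩ | h
      · exact Nat.mod_lt _ (by omega)
      · exact h.1
    have := Finset.card_le_card hsub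
    rw [Finset.card_union_of_disjoint hdisj, Finset.card_range] at this
    omega
  haveI : NeZero k := ⟨by omega⟩
  haveI : Fact (1 < k) := ⟨by omega⟩
  refine ⟨fun z => if z.val = 0 then x else c (i + (z.val - 1)), ?_, ?_⟩
  · intro a b hab
    apply ZMod.val_injective k
    have ha := ZMod.val_lt a
    have hb := ZMod.val_lt b
    dsimp only at hab
    split_ifs at hab with h1 h2 h2
    · omega
    · exact absurd hab (hx _)
    · exact absurd hab.symm (hx _)
    · have := hwin i _ _ (by omega) (by omega) hab
      omega
  · intro z
    have hz := ZMod.val_lt z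
    dsimp only
    rw [ZMod.val_add, ZMod.val_one]
    by_cases hl : z.val + 1 = k
    · rw [hl, Nat.mod_self, if_pos rfl, if_neg (by omega)]
      have : z.val - 1 = k - 2 := by omega
      rwa [this]
    · rw [Nat.mod_eq_of_lt (by omega), if_neg (Nat.succ_ne_zero z.val)]
      by_cases h0 : z.val = 0
      · simpa [h0] using hi1
      · rw [if_neg h0]
        have : i + (z.val + 1 - 1) = i + (z.val - 1) + 1 := by omega
        rw [this]
        exact hcyc _
end

section
/- Let D be a digraph on n ≥ 3 vertices containing a path P = x₁x₂…x_m with 2 ≤ m ≤ n − 1, and let x be a vertex not on this path. Suppose one of the following holds: (i) d(x, P) ≥ m + 2; (ii) d(x, P) ≥ m + 1 and (x x₁ ∉ A(D) or x_m x ∉ A(D)); (iii) d(x, P) ≥ m, x x₁ ∉ A(D) and x_m x ∉ A(D). Then there exists an index i with 1 ≤ i ≤ m − 1 such that x_i x ∈ A(D) and x x_{i+1} ∈ A(D); that is, x can be inserted into P to give a path x₁…x_i x x_{i+1}…x_m of length m. -/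
open PaperDG

open Classical in
theorem bt_count_aux (P Q : ℕ → Prop) (k : ℕ) (h : ∀ i, i < k → Q i → ¬ P (i + 1)) :
    Nat.count P (k + 1) + Nat.count Q (k + 1) ≤
      k + (if P 0 then 1 else 0) + (if Q k then 1 else 0) := by
  induction k with
  | zero => simp [Nat.count_succ]
  | succ k ih =>
    have ih := ih (fun i hi => h i (by omega))
    have h1 := h k (by omega)
    rw [Nat.count_succ P (k + 1), Nat.count_succ Q (k + 1)]
    split_ifs at * <;> first | omega | (exfalso; tauto)

open Classical in
theorem bt_card_aux (P : ℕ → Prop) (m : ℕ) :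
    Nat.card {i : ℕ // i < m ∧ P i} = Nat.count P m := by
  rw [Nat.count_eq_card_filter_range]
  exact Nat.subtype_card _ (by simp)

/-- Lemma 2 (Bondy–Thomassen).  The path `P = x₁x₂…x_m` is encoded by
`p : ℕ → V`, whose vertices are `p 0, …, p (m-1)` (so `x₁ = p 0` and `x_m = p (m-1)`). -/
theorem bondy_thomassen_lemma2 {V : Type*} [Fintype V] (A : V → V → Prop)
    (hirr : ∀ v : V, ¬A v v)
    (hn : 3 ≤ Fintype.card V)
    (m : ℕ) (hm2 : 2 ≤ m) (hm : m ≤ Fintype.card V - 1)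
    (p : ℕ → V)
    (hinjP : ∀ i j : ℕ, i < m → j < m → p i = p j → i = j)
    (hpath : ∀ i : ℕ, i + 1 < m → A (p i) (p (i + 1)))
    (x : V) (hx : ∀ i : ℕ, i < m → x ≠ p i)
    (hcond :
      (m + 2 ≤ Nat.card {i : ℕ // i < m ∧ A x (p i)} +
               Nat.card {i : ℕ // i < m ∧ A (p i) x}) ∨
      ((m + 1 ≤ Nat.card {i : ℕ // i < m ∧ A x (p i)} +
                Nat.card {i : ℕ // i < m ∧ A (p i) x}) ∧
        (¬A x (p 0) ∨ ¬A (p (m - 1)) x)) ∨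
      ((m ≤ Nat.card {i : ℕ // i < m ∧ A x (p i)} +
            Nat.card {i : ℕ // i < m ∧ A (p i) x}) ∧
        ¬A x (p 0) ∧ ¬A (p (m - 1)) x)) :
    ∃ i : ℕ, i + 1 < m ∧ A (p i) x ∧ A x (p (i + 1)) := by
  classical
  by_contra hno
  push Not at hno
  obtain ⟨k, rfl⟩ : ∃ k, m = k + 1 := ⟨m - 1, by omega⟩
  have key := bt_count_aux (fun i => A x (p i)) (fun i => A (p i) x) k
    (fun i hi => hno i (by omega))
  rw [bt_card_aux (fun i => A x (p i)), bt_card_aux (fun i => A (p i) x)] at hcond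
  simp only [Nat.add_sub_cancel] at hcond
  by_cases h0 : A x (p 0) <;> by_cases h1 : A (p k) x <;>
    simp only [h0, h1, if_true, if_false, not_true, not_false_eq_true, and_true, and_false,
      or_false, or_true, or_self] at key hcond <;> omega
end

section
/- For n ≥ 5, let D_{n,n−1} be the digraph with vertex set {x₁, x₂, …, x_n} and arc set {x_i x_j : i < j or i = j + 1} minus the two arcs x₁ x_{n−1} and x₂ x_n. Then D_{n,n−1} is strongly connected, contains no cycle of length n − 1, the only pairs of non-adjacent vertices with a common in-neighbour are {x₁, x_{n−1}} and {x₂, x_n}, condition (*) holds (indeed d(x₁) = d(x_n) = n − 1 and d(x₂) = d(x_{n−1}) = n), and d⁻(x₁) = d⁺(x_n) = 1. -/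
open PaperDG

theorem card_aux (n : ℕ) (P : Fin n → Prop) (S : Finset ℕ)
    (h : ∀ i, i ∈ S ↔ ∃ h : i < n, P ⟨i, h⟩) : Nat.card {w : Fin n // P w} = S.card := by
  rw [← Nat.card_eq_finsetCard S]
  exact Nat.card_congr
    { toFun := fun w => ⟨w.1.1, (h _).2 ⟨w.1.2, w.2⟩⟩
      invFun := fun i => ⟨⟨i.1, ((h _).1 i.2).1⟩, ((h _).1 i.2).2⟩
      left_inv := fun _ => rfl
      right_inv := fun _ => rfl }

theorem cycle_aux (n k : ℕ) (hk : 2 ≤ k) (A : Fin n → Fin n → Prop)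
    (hA : ∀ a b : Fin n, A a b → (a.val < b.val ∨ a.val = b.val + 1))
    (h : HasCycle A k) : ∃ a b : Fin n, A a b ∧ b.val = a.val + (k - 1) := by
  obtain ⟨f, hf, hc⟩ := h
  have : NeZero k := ⟨by omega⟩
  obtain ⟨i0, hi0⟩ := Finite.exists_min (fun i => (f i).val)
  have key : ∀ j : ℕ, j < k → ∀ l : ℕ, l ≤ j → (f (i0 - (l : ZMod k))).val = (f i0).val + l := by
    intro j
    induction j with
    | zero =>
      intro _ l hl
      obtain rfl : l = 0 := by omega
      simp
    | succ j ih =>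
      intro hj l hl
      have ih' := ih (by omega)
      rcases Nat.lt_or_ge l (j + 1) with h1 | h1
      · exact ih' l (by omega)
      obtain rfl : l = j + 1 := by omega
      have e : i0 - ((j + 1 : ℕ) : ZMod k) + 1 = i0 - (j : ZMod k) := by push_cast; ring
      have ha := hA _ _ (hc (i0 - ((j + 1 : ℕ) : ZMod k)))
      rw [e, ih' j le_rfl] at ha
      rcases ha with ha | ha
      · exfalso
        have hm := hi0 (i0 - ((j + 1 : ℕ) : ZMod k))

        obtain ⟨t, ht⟩ := Nat.exists_eq_add_of_le hm
        have htj : t < j := by omega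
        have h2 := ih' t (by omega)
        have h3 := hf (Fin.ext (h2.trans ht.symm))
        have h4 : ((t : ℕ) : ZMod k) = ((j + 1 : ℕ) : ZMod k) := sub_right_injective h3
        rw [ZMod.natCast_eq_natCast_iff', Nat.mod_eq_of_lt (by omega), Nat.mod_eq_of_lt hj] at h4
        omega
      · omega
  refine ⟨f i0, f (i0 + 1), hc i0, ?_⟩
  have := key (k - 1) (by omega) (k - 1) le_rfl
  rw [← this]
  congr 2
  rw [Nat.cast_sub (by omega)]
  simp

/-- Properties of the digraph `D_{n,n-1}`.  The vertex `xᵢ` (for `1 ≤ i ≤ n`) is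
identified with `(⟨i - 1, _⟩ : Fin n)`, so the arc set
`{x_i x_j : i < j or i = j + 1} − {x₁ x_{n-1}, x₂ x_n}` becomes the relation below. -/
theorem D_n_nsub1_properties (n : ℕ) (hn : 5 ≤ n)
    (A : Fin n → Fin n → Prop)
    (hA : ∀ a b : Fin n, A a b ↔
      ((a.val < b.val ∨ a.val = b.val + 1) ∧
        ¬(a.val = 0 ∧ b.val = n - 2) ∧ ¬(a.val = 1 ∧ b.val = n - 1))) :
    IsStrong A ∧
    ¬HasCycle A (n - 1) ∧
    -- the pairs {x₁, x_{n-1}} and {x₂, x_n} are non-adjacent and have a common in-neighbour: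
    (¬A ⟨0, by omega⟩ ⟨n - 2, by omega⟩ ∧ ¬A ⟨n - 2, by omega⟩ ⟨0, by omega⟩ ∧
      (∃ w : Fin n, A w ⟨0, by omega⟩ ∧ A w ⟨n - 2, by omega⟩)) ∧
    (¬A ⟨1, by omega⟩ ⟨n - 1, by omega⟩ ∧ ¬A ⟨n - 1, by omega⟩ ⟨1, by omega⟩ ∧
      (∃ w : Fin n, A w ⟨1, by omega⟩ ∧ A w ⟨n - 1, by omega⟩)) ∧
    -- and they are the only such pairs:
    (∀ u v : Fin n, u ≠ v → ¬A u v → ¬A v u → (∃ w : Fin n, A w u ∧ A w v) →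
      ((u.val = 0 ∧ v.val = n - 2) ∨ (u.val = n - 2 ∧ v.val = 0) ∨
        (u.val = 1 ∧ v.val = n - 1) ∨ (u.val = n - 1 ∧ v.val = 1))) ∧
    CondStar A ∧
    deg A ⟨0, by omega⟩ = n - 1 ∧ deg A ⟨n - 1, by omega⟩ = n - 1 ∧
    deg A ⟨1, by omega⟩ = n ∧ deg A ⟨n - 2, by omega⟩ = n ∧
    inDeg A ⟨0, by omega⟩ = 1 ∧ outDeg A ⟨n - 1, by omega⟩ = 1 := by
  have o0 : outDeg A ⟨0, by omega⟩ = n - 2 := by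
    unfold outDeg
    rw [card_aux n _ ((Finset.Icc 1 (n - 1)).erase (n - 2)), Finset.card_erase_of_mem]
    · simp; omega
    · simp; omega
    · intro i
      simp only [hA, Finset.mem_erase, Finset.mem_Icc, exists_prop]; first | omega | grind
  have i0 : inDeg A ⟨0, by omega⟩ = 1 := by
    unfold inDeg
    rw [card_aux n _ {1}, Finset.card_singleton]
    intro i
    simp only [hA, Finset.mem_singleton, exists_prop]; first | omega | grind
  have on : outDeg A ⟨n - 1, by omega⟩ = 1 := by
    unfold outDeg
    rw [card_aux n _ {n - 2}, Finset.card_singleton]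
    intro i
    simp only [hA, Finset.mem_singleton, exists_prop]; first | omega | grind
  have inn : inDeg A ⟨n - 1, by omega⟩ = n - 2 := by
    unfold inDeg
    rw [card_aux n _ ((Finset.range (n - 1)).erase 1), Finset.card_erase_of_mem]
    · simp; omega
    · simp; omega
    · intro i
      simp only [hA, Finset.mem_erase, Finset.mem_range, exists_prop]; first | omega | grind
  have o1 : outDeg A ⟨1, by omega⟩ = n - 2 := by
    unfold outDeg
    rw [card_aux n _ (insert 0 (Finset.Icc 2 (n - 2))), Finset.card_insert_of_notMem]
    · simp; omega
    · simp
    · intro i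
      simp only [hA, Finset.mem_insert, Finset.mem_Icc, exists_prop]; first | omega | grind
  have i1 : inDeg A ⟨1, by omega⟩ = 2 := by
    unfold inDeg
    rw [card_aux n _ {0, 2}, Finset.card_pair (by omega)]
    intro i
    simp only [hA, Finset.mem_insert, Finset.mem_singleton, exists_prop]; first | omega | grind
  have om : outDeg A ⟨n - 2, by omega⟩ = 2 := by
    unfold outDeg
    rw [card_aux n _ {n - 1, n - 3}, Finset.card_pair (by omega)]
    intro i
    simp only [hA, Finset.mem_insert, Finset.mem_singleton, exists_prop]; first | omega | grind
  have im : inDeg A ⟨n - 2, by omega⟩ = n - 2 := by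
    unfold inDeg
    rw [card_aux n _ (insert (n - 1) (Finset.Icc 1 (n - 3))), Finset.card_insert_of_notMem]
    · simp; omega
    · simp; omega
    · intro i
      simp only [hA, Finset.mem_insert, Finset.mem_Icc, exists_prop]; first | omega | grind
  have d0 : deg A ⟨0, by omega⟩ = n - 1 := by unfold deg; omega
  have dn : deg A ⟨n - 1, by omega⟩ = n - 1 := by unfold deg; omega
  have d1 : deg A ⟨1, by omega⟩ = n := by unfold deg; omega
  have dm : deg A ⟨n - 2, by omega⟩ = n := by unfold deg; omega
  have only : ∀ u v : Fin n, u ≠ v → ¬A u v → ¬A v u → (∃ w : Fin n, A w u ∧ A w v) →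
      ((u.val = 0 ∧ v.val = n - 2) ∨ (u.val = n - 2 ∧ v.val = 0) ∨
        (u.val = 1 ∧ v.val = n - 1) ∨ (u.val = n - 1 ∧ v.val = 1)) := by
    intro u v huv h1 h2 _
    have := Fin.val_ne_of_ne huv
    rw [hA] at h1 h2
    omega
  refine ⟨?_, ?_, ⟨?_, ?_, ⟨1, by omega⟩, ?_⟩, ⟨?_, ?_, ⟨0, by omega⟩, ?_⟩, only, ?_,
    d0, dn, d1, dm, i0, on⟩
  · have down : ∀ d : ℕ, ∀ x y : Fin n, x.val = y.val + d → Relation.ReflTransGen A x y := by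
      intro d
      induction d with
      | zero =>
        intro x y h
        obtain rfl : x = y := Fin.ext h
        exact .refl
      | succ d ih =>
        intro x y h
        refine .head (b := ⟨x.val - 1, by omega⟩) ?_ (ih _ _ ?_)
        · rw [hA]; first | omega | grind
        · first | omega | grind
    intro x y
    refine (down x.val x ⟨0, by omega⟩ (by simp)).trans
      (.head (b := ⟨n - 1, by omega⟩) ?_ (down (n - 1 - y.val) _ _ ?_))
    · rw [hA]; first | omega | grind
    · first | omega | grind
  · intro h
    obtain ⟨a, b, hab, hb⟩ := cycle_aux n (n - 1) (by omega) A (fun a b h => ((hA a b).1 h).1) h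
    rw [hA] at hab
    omega
  · rw [hA]; first | omega | grind
  · rw [hA]; first | omega | grind
  · simp only [hA]; first | omega | grind
  · rw [hA]; first | omega | grind
  · rw [hA]; first | omega | grind
  · simp only [hA]; first | omega | grind
  · intro x y hxy h1 h2 h3
    rw [Fintype.card_fin]
    obtain ⟨x, hx⟩ := x
    obtain ⟨y, hy⟩ := y
    rcases only _ _ hxy h1 h2 h3 with ⟨h4, h5⟩ | ⟨h4, h5⟩ | ⟨h4, h5⟩ | ⟨h4, h5⟩ <;>
    · simp only at h4 h5
      subst h4 h5
      simp only [d0, d1, dn, dm]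
      omega
end
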